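/- arXiv:1508.02239 — 2 statements merged into one kernel-verified Lean document; each statement's English description precedes it below -/
import Mathlib

section
/- Let (Ω,Σ,μ) be a complete finite measure space and let X be an Asplund space. If Γ: Ω ⇉ X* is an integrably bounded, w*-scalarly measurable set-valued mapping with nonempty w*-closed values, then the Gelfand integral I(Γ) = { ∫ f dμ : f ∈ S¹_Γ } is a nonempty subset of X*. -/
open MeasureTheory Filter Topology Metric Set Pointwise
open scoped NNReal ENNReal

noncomputable section

universe u v

namespace Paper

section Defs

variable {X : Type u} [NormedAddCommGroup X] [NormedSpace ℝ X]
variable {Ω : Type v} [MeasurableSpace Ω]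

/-- The identity map from the (strong) dual to the dual endowed with the weak* topology. -/
def wstar : (X →L[ℝ] ℝ) → WeakDual ℝ X := fun φ => φ

/-- Support function `s(x,C)` of a set `C ⊆ X*`. -/
def supp (x : X) (C : Set (X →L[ℝ] ℝ)) : ℝ :=
  sSup ((fun φ : X →L[ℝ] ℝ => φ x) '' C)

/-- `f` is Gelfand integrable: all scalarizations are integrable and the scalar
integrals are represented by a continuous linear functional. -/
def GelfandIntegrable (μ : Measure Ω) (f : Ω → X →L[ℝ] ℝ) : Prop :=
  (∀ x : X, Integrable (fun ω => f ω x) μ) ∧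
    ∃ g : X →L[ℝ] ℝ, ∀ x : X, g x = ∫ ω, f ω x ∂μ

/-- The set `S¹_Γ` of Gelfand-integrable a.e. selectors of `Γ`. -/
def selectors (μ : Measure Ω) (Γ : Ω → Set (X →L[ℝ] ℝ)) : Set (Ω → X →L[ℝ] ℝ) :=
  { f | GelfandIntegrable μ f ∧ ∀ᵐ ω ∂μ, f ω ∈ Γ ω }

/-- The Gelfand integral `I(Γ) = { ∫ f dμ : f ∈ S¹_Γ }` of a multifunction. -/
def gelfandIntegral (μ : Measure Ω) (Γ : Ω → Set (X →L[ℝ] ℝ)) : Set (X →L[ℝ] ℝ) :=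
  { g | ∃ f ∈ selectors μ Γ, ∀ x : X, g x = ∫ ω, f ω x ∂μ }

/-- The set `S^{1,w*}_Γ` of Gelfand-integrable w*-almost selectors of `Γ`. -/
def almostSelectors (μ : Measure Ω) (Γ : Ω → Set (X →L[ℝ] ℝ)) : Set (Ω → X →L[ℝ] ℝ) :=
  { f | GelfandIntegrable μ f ∧ ∀ x : X, ∀ᵐ ω ∂μ, f ω x ≤ supp x (Γ ω) }

/-- `Γ` is w*-scalarly measurable. -/
def WScalarlyMeasurable (Γ : Ω → Set (X →L[ℝ] ℝ)) : Prop :=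
  ∀ x : X, Measurable fun ω => supp x (Γ ω)

/-- `Γ` is w*-scalarly integrable. -/
def WScalarlyIntegrable (μ : Measure Ω) (Γ : Ω → Set (X →L[ℝ] ℝ)) : Prop :=
  ∀ x : X, Integrable (fun ω => supp x (Γ ω)) μ

/-- `Γ` is integrably bounded. -/
def IntegrablyBounded (μ : Measure Ω) (Γ : Ω → Set (X →L[ℝ] ℝ)) : Prop :=
  ∃ ψ : Ω → ℝ, Integrable ψ μ ∧ ∀ ω : Ω, ∀ φ ∈ Γ ω, ‖φ‖ ≤ ψ ω

/-- `C ⊆ X*` is weak*-closed. -/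
def WStarClosed (C : Set (X →L[ℝ] ℝ)) : Prop := IsClosed (wstar '' C)

/-- `C ⊆ X*` is weak*-compact. -/
def WStarCompact (C : Set (X →L[ℝ] ℝ)) : Prop := IsCompact (wstar '' C)

/-- Weak*-closure of `C ⊆ X*`. -/
def wstarClosure (C : Set (X →L[ℝ] ℝ)) : Set (X →L[ℝ] ℝ) :=
  wstar ⁻¹' closure (wstar '' C)

/-- Weak*-closed convex hull of `C ⊆ X*`. -/
def wstarClosedConvexHull (C : Set (X →L[ℝ] ℝ)) : Set (X →L[ℝ] ℝ) :=
  wstar ⁻¹' closure (convexHull ℝ (wstar '' C))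

/-- `Y` is an Asplund space: every continuous convex real function on an open convex
set is Fréchet differentiable on a dense subset of that set. -/
def Asplund (Y : Type*) [NormedAddCommGroup Y] [NormedSpace ℝ Y] : Prop :=
  ∀ U : Set Y, IsOpen U → Convex ℝ U →
    ∀ f : Y → ℝ, ContinuousOn f U → ConvexOn ℝ U f →
      U ⊆ closure { y | y ∈ U ∧ ∃ f' : Y →L[ℝ] ℝ, HasFDerivWithinAt f f' U y }

/-- `μ` is a nonatomic measure. -/
def Nonatomic (μ : Measure Ω) : Prop :=
  ∀ A : Set Ω, MeasurableSet A → 0 < μ A →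
    ∃ B : Set Ω, MeasurableSet B ∧ B ⊆ A ∧ 0 < μ B ∧ μ B < μ A

/-- `μ` is a saturated measure: `L¹` of every positive-measure restriction is nonseparable. -/
def Saturated (μ : Measure Ω) : Prop :=
  ∀ E : Set Ω, MeasurableSet E → 0 < μ E →
    ¬ TopologicalSpace.SeparableSpace (Lp ℝ 1 (μ.restrict E))

/-- `dens(Y)`: smallest cardinality of a dense subset of the open unit ball of `Y`. -/
def densCard (Y : Type u) [NormedAddCommGroup Y] : Cardinal.{u} :=
  sInf { c : Cardinal.{u} |
    ∃ D : Set Y, D ⊆ ball (0 : Y) 1 ∧ ball (0 : Y) 1 ⊆ closure D ∧ Cardinal.mk ↥D = c }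

/-- `dens(Y) < κ(μ)`: every family of `μ`-null measurable sets of cardinality at most
`dens(Y)` has measurable union. -/
def DensLtAdditivity (Y : Type u) [NormedAddCommGroup Y] (μ : Measure Ω) : Prop :=
  ∀ 𝒞 : Set (Set Ω), (∀ A ∈ 𝒞, MeasurableSet A ∧ μ A = 0) →
    Cardinal.lift.{u} (Cardinal.mk ↥𝒞) ≤ Cardinal.lift.{v} (densCard Y) →
    MeasurableSet (⋃₀ 𝒞)

/-- Clarke generalized directional derivative `ψ°(x̄;h)`. -/
def clarkeDD (ψ : X → ℝ) (xbar h : X) : ℝ :=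
  limsup (fun p : X × ℝ => (ψ (p.1 + p.2 • h) - ψ p.1) / p.2) ((𝓝 xbar) ×ˢ (𝓝[>] (0 : ℝ)))

/-- Clarke generalized gradient `∂°ψ(x̄)`. -/
def clarkeSubdiff (ψ : X → ℝ) (xbar : X) : Set (X →L[ℝ] ℝ) :=
  { φ | ∀ h : X, φ h ≤ clarkeDD ψ xbar h }

/-- `ψ` is (Clarke) regular at `x̄`: the directional derivative exists and equals `ψ°`. -/
def ClarkeRegularAt (ψ : X → ℝ) (xbar : X) : Prop :=
  ∀ h : X, Tendsto (fun θ : ℝ => (ψ (xbar + θ • h) - ψ xbar) / θ) (𝓝[>] (0 : ℝ))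
    (𝓝 (clarkeDD ψ xbar h))

/-- Limiting (Mordukhovich) subdifferential `∂ψ(x̄)`. -/
def limitingSubdiff (ψ : X → ℝ) (xbar : X) : Set (X →L[ℝ] ℝ) :=
  { p | ∃ (xk : ℕ → X) (pk : ℕ → X →L[ℝ] ℝ),
      Tendsto xk atTop (𝓝 xbar) ∧
      (∀ z : X, Tendsto (fun k => pk k z) atTop (𝓝 (p z))) ∧
      ∀ k : ℕ, 0 ≤ liminf
        (fun y => (ψ y - ψ (xk k) - pk k (y - xk k)) / ‖y - xk k‖) (𝓝[≠] (xk k)) }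

/-- Clarke generalized normal cone `N°(z̄;C)`. -/
def clarkeNormalCone (C : Set X) (zbar : X) : Set (X →L[ℝ] ℝ) :=
  wstarClosure (⋃ α ∈ Ioi (0 : ℝ), α • clarkeSubdiff (fun z => infDist z C) zbar)

/-- Limiting normal cone `N(z̄;C)`. -/
def limitingNormalCone (C : Set X) (zbar : X) : Set (X →L[ℝ] ℝ) :=
  ⋃ α ∈ Ioi (0 : ℝ), α • limitingSubdiff (fun z => infDist z C) zbar

/-- A multifunction is lower semicontinuous. -/
def LowerSC {Y : Type*} [TopologicalSpace Y] {Z : Type*} [TopologicalSpace Z]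
    (F : Y → Set Z) : Prop :=
  ∀ U : Set Z, IsOpen U → IsOpen { y | (F y ∩ U).Nonempty }

/-- A multifunction is upper semicontinuous. -/
def UpperSC {Y : Type*} [TopologicalSpace Y] {Z : Type*} [TopologicalSpace Z]
    (F : Y → Set Z) : Prop :=
  ∀ U : Set Z, IsOpen U → IsOpen { y | F y ⊆ U }

/-- `P` is a stochastic kernel (transition probability). -/
def StochasticKernel (P : Ω → Measure Ω) : Prop :=
  (∀ ω, IsProbabilityMeasure (P ω)) ∧
    ∀ A : Set Ω, MeasurableSet A → Measurable fun ω => P ω A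

/-- `v` is a bounded Carathéodory solution of the Bellman equation, the minimum
over `Γ x ω` being attained. -/
def BellmanSolution (P : Ω → Measure Ω) (β : ℝ) (u : X → X → Ω → ℝ)
    (Γ : X → Ω → Set X) (v : X → Ω → ℝ) : Prop :=
  (∃ M : ℝ, ∀ x ω, |v x ω| ≤ M) ∧
  (∀ ω, Continuous fun x => v x ω) ∧
  (∀ x, Measurable fun ω => v x ω) ∧
  ∀ x ω,
    (∃ y ∈ Γ x ω, v x ω = u x y ω + β * ∫ ω', v y ω' ∂(P ω)) ∧
    ∀ y ∈ Γ x ω, v x ω ≤ u x y ω + β * ∫ ω', v y ω' ∂(P ω)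

/-- The policy multifunction `G(x,ω)` associated with a Bellman solution `v`. -/
def policyMap (P : Ω → Measure Ω) (β : ℝ) (u : X → X → Ω → ℝ)
    (Γ : X → Ω → Set X) (v : X → Ω → ℝ) (x : X) (ω : Ω) : Set X :=
  { y ∈ Γ x ω | v x ω = u x y ω + β * ∫ ω', v y ω' ∂(P ω) }

/-- Standing assumptions (H1), (H2) on the stochastic DP problem. -/
def DPStandingAssumptions [MeasurableSpace X] (P : Ω → Measure Ω) (β : ℝ)
    (u : X → X → Ω → ℝ) (Γ : X → Ω → Set X) : Prop :=
  StochasticKernel P ∧ 0 ≤ β ∧ β < 1 ∧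
  (∃ M : ℝ, ∀ x y ω, |u x y ω| ≤ M) ∧
  (∀ ω, Continuous fun p : X × X => u p.1 p.2 ω) ∧
  (∀ x y, Measurable fun ω => u x y ω) ∧
  (∀ x ω, (Γ x ω).Nonempty ∧ IsCompact (Γ x ω)) ∧
  (∀ U : Set X, IsOpen U → MeasurableSet { p : X × Ω | (Γ p.1 p.2 ∩ U).Nonempty }) ∧
  (∀ ω, LowerSC (fun x => Γ x ω) ∧ UpperSC (fun x => Γ x ω)) ∧
  (∀ x, ∀ U : Set X, IsOpen U → MeasurableSet { ω | (Γ x ω ∩ U).Nonempty })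

/-- `G` is locally lower viable around `x̄` (relative to `Γ`). -/
def LocLowerViable (G Γ : X → Ω → Set X) (xbar : X) : Prop :=
  ∀ ω, ∃ U ∈ 𝓝 xbar, ∀ x ∈ U, ∀ x' ∈ U, (G x ω ∩ Γ x' ω).Nonempty

/-- `G` is locally upper viable around `x̄` (relative to `Γ`). -/
def LocUpperViable (G Γ : X → Ω → Set X) (xbar : X) : Prop :=
  ∀ ω, ∃ U ∈ 𝓝 xbar, ∀ x ∈ U, ∀ x' ∈ U, G x ω ⊆ Γ x' ω

end Defs

theorem aemeasurable_of_squeeze {Ω : Type*} [MeasurableSpace Ω] {μ : Measure Ω}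
    {f : Ω → ℝ} {L U : ℕ → Ω → ℝ} (hLm : ∀ n, Measurable (L n)) (hUm : ∀ n, Measurable (U n))
    (hint : ∀ n, Integrable (fun ω => U n ω - L n ω) μ)
    (hL : ∀ n ω, L n ω ≤ f ω) (hU : ∀ n ω, f ω ≤ U n ω)
    (hlim : Tendsto (fun n => ∫ ω, (U n ω - L n ω) ∂μ) atTop (𝓝 0)) : AEMeasurable f μ := by
  have hbelow (ω) : BddBelow (range fun n => U n ω) := ⟨f ω, by rintro _ ⟨n, rfl⟩; exact hU n ω⟩
  have habove (ω) : BddAbove (range fun n => L n ω) := ⟨f ω, by rintro _ ⟨n, rfl⟩; exact hL n ω⟩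
  have hfu (ω) : f ω ≤ ⨅ n, U n ω := le_ciInf fun n => hU n ω
  have hlf (ω) : ⨆ n, L n ω ≤ f ω := ciSup_le fun n => hL n ω
  have hmu : Measurable fun ω => ⨅ n, U n ω := Measurable.iInf hUm
  have hml : Measurable fun ω => ⨆ n, L n ω := Measurable.iSup hLm
  have hle (n) (ω) : (⨅ n, U n ω) - (⨆ n, L n ω) ≤ U n ω - L n ω :=
    sub_le_sub (ciInf_le (hbelow ω) n) (le_ciSup (habove ω) n)
  have h0 : 0 ≤ fun ω => (⨅ n, U n ω) - (⨆ n, L n ω) :=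
    fun ω => sub_nonneg.2 ((hlf ω).trans (hfu ω))
  have hi : Integrable (fun ω => (⨅ n, U n ω) - (⨆ n, L n ω)) μ :=
    (hint 0).mono (hmu.sub hml).aestronglyMeasurable <| ae_of_all _ fun ω => by
      rw [Real.norm_of_nonneg (h0 ω)]
      exact (hle 0 ω).trans (Real.le_norm_self _)
  have hz : ∫ ω, ((⨅ n, U n ω) - (⨆ n, L n ω)) ∂μ = 0 :=
    le_antisymm (ge_of_tendsto' hlim fun n => integral_mono hi (hint n) (hle n))
      (integral_nonneg h0)
  refine ⟨_, hmu, ?_⟩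
  filter_upwards [(integral_eq_zero_iff_of_nonneg h0 hi).1 hz] with ω hω
  exact le_antisymm (hfu ω) ((sub_eq_zero.1 hω).le.trans (hlf ω))

section Supp

variable {X : Type*} [NormedAddCommGroup X] [NormedSpace ℝ X] {C : Set (X →L[ℝ] ℝ)} {r : ℝ}

theorem apply_le_supp (hC : ∀ φ ∈ C, ‖φ‖ ≤ r) {φ : X →L[ℝ] ℝ} (hφ : φ ∈ C) (x : X) :
    φ x ≤ supp x C := by
  refine le_csSup ⟨r * ‖x‖, ?_⟩ ⟨φ, hφ, rfl⟩
  rintro _ ⟨φ, hφ, rfl⟩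
  exact (le_abs_self _).trans (φ.le_of_opNorm_le (hC φ hφ) x)

theorem supp_le (hne : C.Nonempty) {x : X} {a : ℝ} (h : ∀ φ ∈ C, φ x ≤ a) : supp x C ≤ a :=
  csSup_le (hne.image _) (by rintro _ ⟨φ, hφ, rfl⟩; exact h φ hφ)

theorem supp_le_supp_add (hne : C.Nonempty) (hC : ∀ φ ∈ C, ‖φ‖ ≤ r) (x y : X) :
    supp x C ≤ supp y C + r * ‖x - y‖ := by
  refine supp_le hne fun φ hφ => ?_
  have h1 := apply_le_supp hC hφ y
  have h2 := (le_abs_self _).trans (φ.le_of_opNorm_le (hC φ hφ) (x - y))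
  rw [map_sub] at h2
  linarith

theorem abs_supp_le (hne : C.Nonempty) (hC : ∀ φ ∈ C, ‖φ‖ ≤ r) (x : X) :
    |supp x C| ≤ r * ‖x‖ := by
  obtain ⟨φ, hφ⟩ := hne
  have h1 := (abs_le.1 (φ.le_of_opNorm_le (hC φ hφ) x)).1
  exact abs_le.2 ⟨h1.trans (apply_le_supp hC hφ x), supp_le ⟨φ, hφ⟩ fun φ hφ =>
    (le_abs_self _).trans (φ.le_of_opNorm_le (hC φ hφ) x)⟩

theorem convexOn_supp (hne : C.Nonempty) (hC : ∀ φ ∈ C, ‖φ‖ ≤ r) :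
    ConvexOn ℝ univ fun x : X => supp x C := by
  refine ⟨convex_univ, fun x _ y _ a b ha hb _ => supp_le hne fun φ hφ => ?_⟩
  simp only [map_add, map_smul, smul_eq_mul]
  exact add_le_add (mul_le_mul_of_nonneg_left (apply_le_supp hC hφ x) ha)
    (mul_le_mul_of_nonneg_left (apply_le_supp hC hφ y) hb)

theorem exists_apply_eq_supp (hne : C.Nonempty) (hC : ∀ φ ∈ C, ‖φ‖ ≤ r) (hcl : WStarClosed C)
    (x : X) : ∃ φ ∈ C, φ x = supp x C := by
  have hcpt : IsCompact (wstar '' C) := by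
    refine (WeakDual.isCompact_closedBall 0 r).of_isClosed_subset hcl ?_
    rintro _ ⟨φ, hφ, rfl⟩
    exact mem_closedBall_zero_iff.2 (hC φ hφ)
  obtain ⟨_, ⟨φ, hφ, rfl⟩, hmax⟩ :=
    hcpt.exists_isMaxOn (hne.image _) (WeakDual.eval_continuous x).continuousOn
  exact ⟨φ, hφ, le_antisymm (apply_le_supp hC hφ x)
    (supp_le hne fun φ' hφ' => hmax (mem_image_of_mem wstar hφ'))⟩

end Supp

/-- nonemptiness of the Gelfand integral of an integrably bounded,
w*-scalarly measurable multifunction with nonempty w*-closed values, over a complete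
finite measure space, with `X` Asplund. -/
theorem gelfand_integral_nonempty
    {X : Type u} [NormedAddCommGroup X] [NormedSpace ℝ X] [CompleteSpace X]
    (hX : Asplund X)
    {Ω : Type v} [MeasurableSpace Ω] (μ : Measure Ω)
    (hcomp : μ.IsComplete) [IsFiniteMeasure μ]
    (Γ : Ω → Set (X →L[ℝ] ℝ))
    (hne : ∀ ω, (Γ ω).Nonempty)
    (hcl : ∀ ω, WStarClosed (Γ ω))
    (hb : IntegrablyBounded μ Γ)
    (hm : WScalarlyMeasurable Γ) :
    (gelfandIntegral μ Γ).Nonempty := by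
  obtain ⟨ψ, hψ, hbd⟩ := hb
  have hint (x : X) : Integrable (fun ω => supp x (Γ ω)) μ :=
    (hψ.mul_const ‖x‖).mono' (hm x).aestronglyMeasurable
      (ae_of_all _ fun ω => abs_supp_le (hne ω) (hbd ω) x)
  set Φ : X → ℝ := fun x => ∫ ω, supp x (Γ ω) ∂μ with hΦ
  have hcont : Continuous Φ := by
    refine (LipschitzWith.of_le_add_mul (∫ ω, ψ ω ∂μ).toNNReal fun x y => ?_).continuous
    have h0 : 0 ≤ ∫ ω, ψ ω ∂μ := integral_nonneg fun ω =>
      let ⟨φ, hφ⟩ := hne ω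
      (norm_nonneg φ).trans (hbd ω φ hφ)
    rw [Real.coe_toNNReal _ h0, dist_eq_norm, ← integral_mul_const,
      ← integral_add (hint y) (hψ.mul_const _)]
    exact integral_mono (hint x) ((hint y).add (hψ.mul_const _)) fun ω =>
      supp_le_supp_add (hne ω) (hbd ω) x y
  have hconv : ConvexOn ℝ univ Φ := by
    refine ⟨convex_univ, fun x _ y _ a b ha hb hab => ?_⟩
    simp only [hΦ, smul_eq_mul]
    rw [← integral_const_mul, ← integral_const_mul,
      ← integral_add ((hint x).const_mul a) ((hint y).const_mul b)]
    exact integral_mono (hint _) (((hint x).const_mul a).add ((hint y).const_mul b)) fun ω =>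
      (convexOn_supp (hne ω) (hbd ω)).2 (mem_univ x) (mem_univ y) ha hb hab
  obtain ⟨x₀, -, Φ', hΦ'⟩ : {y | y ∈ univ ∧ ∃ f' : X →L[ℝ] ℝ,
      HasFDerivWithinAt Φ f' univ y}.Nonempty :=
    closure_nonempty_iff.1 ⟨0, hX univ isOpen_univ convex_univ Φ hcont.continuousOn hconv trivial⟩
  rw [hasFDerivWithinAt_univ] at hΦ'
  choose f hfΓ hfx₀ using fun ω => exists_apply_eq_supp (hne ω) (hbd ω) (hcl ω) x₀
  -- At a point where `Φ` is differentiable, the exposed faces are scalarly a.e. single-valued.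
  let D (h : X) (n : ℕ) (ω : Ω) : ℝ :=
    n * (supp (x₀ + (n : ℝ)⁻¹ • h) (Γ ω) - supp x₀ (Γ ω))
  have hDm (h n) : Measurable (D h n) := ((hm _).sub (hm _)).const_mul _
  have hDi (h n) : Integrable (D h n) μ := ((hint _).sub (hint _)).const_mul _
  have hDlim (h) : Tendsto (fun n => ∫ ω, D h n ω ∂μ) atTop (𝓝 (Φ' h)) := by
    refine ((hΦ'.lim_real h).comp tendsto_natCast_atTop_atTop).congr fun n => ?_
    simp only [D, hΦ, Function.comp_apply, smul_eq_mul]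
    rw [integral_const_mul, integral_sub (hint _) (hint _)]
  have hfD (h : X) (n : ℕ) (ω : Ω) : f ω h ≤ D h (n + 1) ω := by
    have h1 := apply_le_supp (hbd ω) (hfΓ ω) (x₀ + ((n + 1 : ℕ) : ℝ)⁻¹ • h)
    rw [map_add, map_smul, hfx₀, smul_eq_mul, ← le_sub_iff_add_le',
      inv_mul_le_iff₀ (by positivity)] at h1
    exact h1
  have hfm (h : X) : AEMeasurable (fun ω => f ω h) μ := by
    refine aemeasurable_of_squeeze (L := fun n ω => -D (-h) (n + 1) ω)
      (U := fun n => D h (n + 1)) (fun n => (hDm _ _).neg) (fun n => hDm _ _)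
      (fun n => (hDi _ _).sub (hDi _ _).neg) (fun n ω => ?_) (hfD h) ?_
    · have := hfD (-h) n ω
      rw [map_neg] at this
      exact neg_le.1 this
    · have hlim := ((hDlim h).add (hDlim (-h))).comp (tendsto_add_atTop_nat 1)
      rw [map_neg, add_neg_cancel] at hlim
      refine hlim.congr fun n => ?_
      simp only [sub_neg_eq_add, Function.comp_apply]
      rw [integral_add (hDi _ _) (hDi _ _)]
  have hfb (x : X) (ω : Ω) : ‖f ω x‖ ≤ ψ ω * ‖x‖ := (f ω).le_of_opNorm_le (hbd ω _ (hfΓ ω)) x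
  have hfi (x : X) : Integrable (fun ω => f ω x) μ :=
    (hψ.mul_const ‖x‖).mono' (hfm x).aestronglyMeasurable (ae_of_all _ (hfb x))
  let g : X →L[ℝ] ℝ := LinearMap.mkContinuous
    { toFun := fun x => ∫ ω, f ω x ∂μ
      map_add' := fun x y => by simp only [map_add]; exact integral_add (hfi x) (hfi y)
      map_smul' := fun a x => by simp [integral_const_mul] }
    (∫ ω, ψ ω ∂μ) fun x => by
      rw [← integral_mul_const]
      exact norm_integral_le_of_norm_le (hψ.mul_const _) (ae_of_all _ (hfb x))
  exact ⟨g, f, ⟨⟨hfi, g, fun _ => rfl⟩, ae_of_all _ hfΓ⟩, fun _ => rfl⟩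

end Paper
end
end

section
/- Let (Ω,Σ,μ) be a complete nonatomic finite measure space and let X be an Asplund space with dens(X) < κ(μ). If Γ: Ω ⇉ X* is an integrably bounded, w*-scalarly measurable multifunction with nonempty w*-closed values admitting at least one Gelfand-integrable selector, then the weak*-closure of I(Γ) is weak*-compact and convex and satisfies cl^{w*} I(Γ) = I( cl^{w*} co Γ ), where cl^{w*} co Γ is the multifunction ω ↦ weak*-closed convex hull of Γ(ω). -/
open MeasureTheory Filter Topology Metric Set Pointwise
open scoped NNReal ENNReal

noncomputable section

universe u v

namespace Paper

/-- Brezis–Browder ordering principle: a bounded monotone functional on a preorder in which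
increasing sequences are bounded above is eventually constant above some point. -/
theorem exists_stable_of_monotone {P : Type*} [Preorder P] [Nonempty P]
    (hseq : ∀ w : ℕ → P, Monotone w → ∃ p, ∀ n, w n ≤ p) {φ : P → ℝ≥0∞} (hφ : Monotone φ)
    {M : ℝ≥0∞} (hM : M ≠ ∞) (hφM : ∀ p, φ p ≤ M) : ∃ p, ∀ q, p ≤ q → φ q = φ p := by
  set a : P → ℝ≥0∞ := fun p => ⨆ q : {q // p ≤ q}, φ q with ha
  have hstep : ∀ (n : ℕ) (p : P), ∃ q, p ≤ q ∧ a p ≤ φ q + ((n : ℝ≥0∞) + 1)⁻¹ := by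
    intro n p
    have hε : ((n : ℝ≥0∞) + 1)⁻¹ ≠ 0 := by simp
    have hap : a p ≠ ∞ := ne_top_of_le_ne_top hM (iSup_le fun q => hφM _)
    by_cases h0 : a p = 0
    · exact ⟨p, le_rfl, by simp [h0]⟩
    · obtain ⟨q, hq⟩ := lt_iSup_iff.1 (ENNReal.sub_lt_self hap h0 hε)
      exact ⟨q, q.2, tsub_le_iff_right.1 hq.le⟩
  choose nxt hle hnxt using hstep
  obtain ⟨p₀⟩ := ‹Nonempty P›
  let w : ℕ → P := fun n => Nat.rec p₀ (fun k p => nxt k p) n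
  have hw : Monotone w := monotone_nat_of_le_succ fun n => hle n (w n)
  obtain ⟨p, hp⟩ := hseq w hw
  refine ⟨p, fun q hpq => le_antisymm ?_ (hφ hpq)⟩
  have hlim : Tendsto (fun n : ℕ => φ p + ((n : ℝ≥0∞) + 1)⁻¹) atTop (𝓝 (φ p + 0)) := by
    refine Tendsto.add tendsto_const_nhds ?_
    have := (tendsto_add_atTop_iff_nat 1).2 ENNReal.tendsto_inv_nat_nhds_zero
    simpa using this
  rw [add_zero] at hlim
  refine ge_of_tendsto' hlim fun n => ?_
  calc φ q ≤ a (w n) := le_iSup (fun q : {q // w n ≤ q} => φ q) ⟨q, (hp n).trans hpq⟩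
    _ ≤ φ (w (n + 1)) + ((n : ℝ≥0∞) + 1)⁻¹ := hnxt n (w n)
    _ ≤ _ := by gcongr; exact hφ (hp (n + 1))

section Measure

variable {Ω : Type v} [MeasurableSpace Ω]

theorem Nonatomic.exists_subset_measure_le {μ : Measure Ω} [IsFiniteMeasure μ]
    (hna : Nonatomic μ) {A : Set Ω} (hA : MeasurableSet A) (h0 : 0 < μ A) {ε : ℝ≥0∞}
    (hε : 0 < ε) : ∃ B, MeasurableSet B ∧ B ⊆ A ∧ 0 < μ B ∧ μ B ≤ ε := by
  have half : ∀ A : Set Ω, MeasurableSet A → 0 < μ A →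
      ∃ B, MeasurableSet B ∧ B ⊆ A ∧ 0 < μ B ∧ μ B ≤ μ A / 2 := by
    intro A hA h0
    obtain ⟨B, hB, hBA, hB0, hBlt⟩ := hna A hA h0
    rcases le_total (μ B) (μ A / 2) with h | h
    · exact ⟨B, hB, hBA, hB0, h⟩
    · refine ⟨A \ B, hA.diff hB, sdiff_subset, ?_, ?_⟩
      · rw [measure_sdiff hBA hB.nullMeasurableSet (measure_ne_top _ _)]
        exact tsub_pos_of_lt hBlt
      · rw [measure_sdiff hBA hB.nullMeasurableSet (measure_ne_top _ _), tsub_le_iff_right]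
        calc μ A = μ A / 2 + μ A / 2 := (ENNReal.add_halves _).symm
          _ ≤ _ := by gcongr
  have iter : ∀ n : ℕ, ∃ B, MeasurableSet B ∧ B ⊆ A ∧ 0 < μ B ∧ μ B ≤ μ A * 2⁻¹ ^ n := by
    intro n
    induction n with
    | zero => exact ⟨A, hA, Subset.rfl, h0, by simp⟩
    | succ n ih =>
      obtain ⟨B, hB, hBA, hB0, hBle⟩ := ih
      obtain ⟨C, hC, hCB, hC0, hCle⟩ := half B hB hB0
      refine ⟨C, hC, hCB.trans hBA, hC0, hCle.trans ?_⟩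
      rw [pow_succ, ← mul_assoc, ENNReal.div_eq_inv_mul, mul_comm]
      gcongr
  have hlim : Tendsto (fun n : ℕ => μ A * 2⁻¹ ^ n) atTop (𝓝 (μ A * 0)) :=
    ENNReal.Tendsto.const_mul
      (ENNReal.tendsto_pow_atTop_nhds_zero_of_lt_one (by simp)) (Or.inr (measure_ne_top _ _))
  rw [mul_zero] at hlim
  obtain ⟨n, hn⟩ := (hlim.eventually_lt_const hε).exists
  obtain ⟨B, hB, hBA, hB0, hBle⟩ := iter n
  exact ⟨B, hB, hBA, hB0, hBle.trans hn.le⟩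

/-- Sierpiński's theorem on the range of a nonatomic measure. -/
theorem Nonatomic.exists_subset_measure_eq {μ : Measure Ω} [IsFiniteMeasure μ]
    (hna : Nonatomic μ) {A : Set Ω} (hA : MeasurableSet A) {t : ℝ≥0∞} (ht : t ≤ μ A) :
    ∃ B, MeasurableSet B ∧ B ⊆ A ∧ μ B = t := by
  let P := {B : Set Ω // MeasurableSet B ∧ B ⊆ A ∧ μ B ≤ t}
  have : Nonempty P := ⟨⟨∅, MeasurableSet.empty, empty_subset _, by simp⟩⟩
  obtain ⟨⟨B, hB, hBA, hBt⟩, hmax⟩ := exists_stable_of_monotone (P := P) (φ := fun B => μ B.1)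
    (M := μ A)
    (fun w hw => ⟨⟨⋃ n, (w n).1, MeasurableSet.iUnion fun n => (w n).2.1,
      iUnion_subset fun n => (w n).2.2.1, by
        rw [Monotone.measure_iUnion (fun i j hij => hw hij)]
        exact iSup_le fun n => (w n).2.2.2⟩, fun n => subset_iUnion (fun n => (w n).1) n⟩)
    (fun B C h => measure_mono h) (measure_ne_top _ _) (fun B => measure_mono B.2.2.1)
  refine ⟨B, hB, hBA, hBt.eq_of_not_lt fun hlt => ?_⟩
  have hpos : 0 < μ (A \ B) := by
    rw [measure_sdiff hBA hB.nullMeasurableSet (measure_ne_top _ _)]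
    exact tsub_pos_of_lt (hlt.trans_le ht)
  obtain ⟨C, hC, hCA, hC0, hCle⟩ := hna.exists_subset_measure_le (hA.diff hB) hpos
    (tsub_pos_of_lt hlt)
  have hdisj : Disjoint B C := disjoint_sdiff_right.mono_right hCA
  have hμ : μ (B ∪ C) = μ B + μ C := measure_union hdisj hC
  have := hmax ⟨B ∪ C, hB.union hC, union_subset hBA (hCA.trans sdiff_subset), by
    rw [hμ]
    exact (add_le_add_right hCle (μ B)).trans (add_tsub_cancel_of_le hBt).le⟩ subset_union_left
  simp only [hμ] at this
  exact (ENNReal.lt_add_right (measure_ne_top μ B) hC0.ne').ne' this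

/-- An approximate form of Lyapunov's convexity theorem. -/
theorem Nonatomic.exists_setIntegral_sub_smul_norm_lt {μ : Measure Ω} [IsFiniteMeasure μ]
    (hna : Nonatomic μ) {E : Type*} [NormedAddCommGroup E] [NormedSpace ℝ E]
    [CompleteSpace E]
    {h : Ω → E} (hh : Integrable h μ) {t : ℝ} (ht0 : 0 ≤ t) (ht1 : t ≤ 1) {ε : ℝ} (hε : 0 < ε) :
    ∃ A, MeasurableSet A ∧ ‖∫ ω in A, h ω ∂μ - t • ∫ ω, h ω ∂μ‖ < ε := by
  obtain ⟨s, hs, hsint⟩ := (memLp_one_iff_integrable.2 hh).exists_simpleFunc_eLpNorm_sub_lt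
    ENNReal.one_ne_top (ε := ENNReal.ofReal (ε / 2)) (by simpa using hε)
  rw [memLp_one_iff_integrable] at hsint
  have hsplit : ∀ c : E, ∃ B, MeasurableSet B ∧ B ⊆ s ⁻¹' {c} ∧
      μ B = ENNReal.ofReal t * μ (s ⁻¹' {c}) := fun c =>
    hna.exists_subset_measure_eq (s.measurableSet_fiber c) (by
      calc _ ≤ 1 * μ (s ⁻¹' {c}) := by gcongr; simpa using ht1
        _ = _ := one_mul _)
  choose B hB hBs hBμ using hsplit
  refine ⟨⋃ c ∈ s.range, B c, Finset.measurableSet_biUnion _ fun c _ => hB c, ?_⟩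
  set A := ⋃ c ∈ s.range, B c with hAdef
  have hA : MeasurableSet A := Finset.measurableSet_biUnion _ fun c _ => hB c
  have hfib : ∀ c ∈ s.range, s ⁻¹' {c} ∩ A = B c := by
    intro c hc
    ext ω
    simp only [hAdef, mem_inter_iff, mem_iUnion, mem_preimage, mem_singleton_iff]
    constructor
    · rintro ⟨h1, d, -, h2⟩
      have : s ω = d := hBs d h2
      rwa [← h1, this]
    · intro h
      exact ⟨hBs c h, c, hc, h⟩
  have hsA : ∫ ω in A, s ω ∂μ = t • ∫ ω, s ω ∂μ := by
    rw [← SimpleFunc.integral_eq_integral s hsint,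
      ← SimpleFunc.integral_eq_integral s hsint.integrableOn, SimpleFunc.integral_eq,
      SimpleFunc.integral_eq, Finset.smul_sum]
    refine Finset.sum_congr rfl fun c hc => ?_
    rw [measureReal_restrict_apply (s.measurableSet_fiber c), hfib c hc, smul_smul]
    congr 1
    rw [measureReal_def, hBμ, ENNReal.toReal_mul, ENNReal.toReal_ofReal ht0, measureReal_def]
  have hd : Integrable (fun ω => h ω - s ω) μ := hh.sub hsint
  have hdn : ∫ ω, ‖h ω - s ω‖ ∂μ < ε / 2 := by
    rw [integral_norm_eq_lintegral_enorm hd.aestronglyMeasurable]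
    refine ENNReal.toReal_lt_of_lt_ofReal ?_
    rw [eLpNorm_one_eq_lintegral_enorm] at hs
    exact hs
  have h1 : ‖∫ ω in A, (h ω - s ω) ∂μ‖ < ε / 2 :=
    ((norm_integral_le_integral_norm _).trans
      (setIntegral_le_integral hd.norm (Eventually.of_forall fun _ => norm_nonneg _))).trans_lt hdn
  have h2 : ‖t • ∫ ω, (h ω - s ω) ∂μ‖ < ε / 2 := by
    rw [norm_smul, Real.norm_of_nonneg ht0]
    calc _ ≤ 1 * ‖∫ ω, (h ω - s ω) ∂μ‖ := by gcongr
      _ < ε / 2 := by rw [one_mul]; exact (norm_integral_le_integral_norm _).trans_lt hdn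
  have heq : ∫ ω in A, h ω ∂μ - t • ∫ ω, h ω ∂μ
      = ∫ ω in A, (h ω - s ω) ∂μ - t • ∫ ω, (h ω - s ω) ∂μ := by
    rw [integral_sub hh.integrableOn hsint.integrableOn, integral_sub hh hsint, hsA, smul_sub]
    abel
  rw [heq]
  exact (norm_sub_le _ _).trans_lt (by linarith)

/-- If all unions of `ι`-indexed families of null sets are measurable, then up to a
measurable set all of whose subsets are measurable, such unions are null. -/
theorem exists_total_part {μ : Measure Ω} [IsFiniteMeasure μ] {ι : Type*} [Nonempty ι]
    (e : ι ≃ ℕ × ι)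
    (hι : ∀ N : ι → Set Ω, (∀ i, μ (N i) = 0) → MeasurableSet (⋃ i, N i)) :
    ∃ Z : Set Ω, MeasurableSet Z ∧ (∀ A ⊆ Z, MeasurableSet A) ∧
      ∀ N : ι → Set Ω, (∀ i, μ (N i) = 0) → μ ((⋃ i, N i) \ Z) = 0 := by
  let P := {J : Set Ω // ∃ N : ι → Set Ω, (∀ i, μ (N i) = 0) ∧ J = ⋃ i, N i}
  have hsup : ∀ w : ℕ → P, ∃ p : P, p.1 = ⋃ n, (w n).1 := by
    intro w
    choose N hN hJ using fun n => (w n).2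
    refine ⟨⟨⋃ n, (w n).1, fun i => N (e i).1 (e i).2, fun i => hN _ _, ?_⟩, rfl⟩
    rw [e.surjective.iUnion_comp (fun p => N p.1 p.2), iUnion_prod']
    exact iUnion_congr hJ
  have : Nonempty P := ⟨⟨∅, fun _ => ∅, by simp, by simp⟩⟩
  obtain ⟨⟨Z, N, hN, hZ⟩, hmax⟩ := exists_stable_of_monotone (P := P) (φ := fun B => μ B.1)
    (M := μ univ)
    (fun w _ => (hsup w).imp fun p hp n => by
      change (w n).1 ⊆ p.1
      rw [hp]
      exact subset_iUnion (fun n => (w n).1) n)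
    (fun B C h => measure_mono h) (measure_ne_top _ _) (fun B => measure_mono (subset_univ _))
  have hZm : MeasurableSet Z := hZ ▸ hι N hN
  refine ⟨Z, hZm, fun A hA => ?_, fun N' hN' => ?_⟩
  · have : A = ⋃ i, A ∩ N i := by rw [← inter_iUnion, ← hZ, inter_eq_left.2 hA]
    rw [this]
    exact hι _ fun i => measure_mono_null inter_subset_right (hN i)
  · obtain ⟨p, hp⟩ := hsup fun n => if n = 0 then ⟨Z, N, hN, hZ⟩ else ⟨_, N', hN', rfl⟩
    have h1 : Z ⊆ p.1 := by
      rw [hp]; exact subset_iUnion_of_subset 0 (by simp)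
    have h2 : ⋃ i, N' i ⊆ p.1 := by
      rw [hp]; exact subset_iUnion_of_subset 1 (by simp)
    have := hmax p h1
    refine measure_mono_null (sdiff_subset_sdiff_left h2) ?_
    rw [measure_sdiff h1 hZm.nullMeasurableSet (measure_ne_top _ _), this, tsub_self]

/-- On a finite measure space all of whose subsets are measurable, a decreasing family of
ordinal-valued functions indexed by countable sets stabilizes almost everywhere. -/
theorem exists_countable_ae_stable {ν : Measure Ω} [IsFiniteMeasure ν]
    (hν : ∀ A : Set Ω, NullMeasurableSet A ν) {T : Type*} {β : Set T → Ω → Ordinal.{u}}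
    (hβ : ∀ F G : Set T, F ⊆ G → ∀ ω, β G ω ≤ β F ω) :
    ∃ F₀ : Set T, F₀.Countable ∧
      ∀ F : Set T, F.Countable → F₀ ⊆ F → ∀ᵐ ω ∂ν, β F ω = β F₀ ω := by
  let P := {F : Set T // F.Countable}
  let a : P → ℝ≥0∞ := fun F => ⨆ G : {G : P // F.1 ⊆ G.1}, ν {ω | β G.1.1 ω < β F.1 ω}
  have hstep : ∀ F : P, ∃ G : P, F.1 ⊆ G.1 ∧ a F ≤ 2 * ν {ω | β G.1 ω < β F.1 ω} := by
    intro F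
    have haF : a F ≠ ∞ :=
      ne_top_of_le_ne_top (measure_ne_top ν univ) (iSup_le fun q => measure_mono (subset_univ _))
    by_cases h0 : a F = 0
    · exact ⟨F, Subset.rfl, by simp [h0]⟩
    · obtain ⟨q, hq⟩ := lt_iSup_iff.1 (ENNReal.half_lt_self h0 haF)
      refine ⟨q, q.2, ?_⟩
      rw [mul_comm]
      exact (ENNReal.div_le_iff (by simp) (by simp)).1 hq.le
  choose nxt hle hnxt using hstep
  let w : ℕ → P := fun n => Nat.rec ⟨∅, countable_empty⟩ (fun _ p => nxt p) n
  let A : ℕ → Set Ω := fun n => {ω | β (w (n + 1)).1 ω < β (w n).1 ω}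
  have hanti : Antitone fun n => ⋃ m : {m // n ≤ m}, A m.1 := by
    intro n k hnk
    exact iUnion_subset fun m => subset_iUnion (fun m : {m // n ≤ m} => A m.1) ⟨m, hnk.trans m.2⟩
  have hempty : ⋂ n, ⋃ m : {m // n ≤ m}, A m.1 = ∅ := by
    rw [eq_empty_iff_forall_notMem]
    intro ω hω
    have hdec : Antitone fun n => β (w n).1 ω :=
      antitone_nat_of_succ_le fun n => hβ _ _ (hle (w n)) ω
    obtain ⟨_, ⟨n, rfl⟩, hn⟩ :=
      wellFounded_lt.has_min (range fun n => β (w n).1 ω) (range_nonempty _)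
    obtain ⟨⟨m, hm⟩, hlt⟩ := mem_iUnion.1 (mem_iInter.1 hω n)
    exact hn _ ⟨m + 1, rfl⟩ (hlt.trans_le (hdec hm))
  have hlim := tendsto_measure_iInter_atTop (μ := ν) (fun n => hν _) hanti ⟨0, measure_ne_top _ _⟩
  rw [hempty, measure_empty] at hlim
  refine ⟨⋃ n, (w n).1, countable_iUnion fun n => (w n).2, fun F hF hsub => ?_⟩
  have hbound : ∀ n, ν {ω | β F ω < β (⋃ n, (w n).1) ω} ≤ 2 * ν (⋃ m : {m // n ≤ m}, A m.1) := by
    intro n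
    calc ν {ω | β F ω < β (⋃ n, (w n).1) ω} ≤ ν {ω | β F ω < β (w n).1 ω} :=
          measure_mono fun ω hω => lt_of_lt_of_le hω (hβ _ _ (subset_iUnion (fun n => (w n).1) n) ω)
      _ ≤ a (w n) := le_iSup (fun G : {G : P // (w n).1 ⊆ G.1} => ν {ω | β G.1.1 ω < β (w n).1 ω})
          ⟨⟨F, hF⟩, (subset_iUnion (fun n => (w n).1) n).trans hsub⟩
      _ ≤ 2 * ν (A n) := hnxt (w n)
      _ ≤ _ := by gcongr; exact subset_iUnion (fun m : {m // n ≤ m} => A m.1) ⟨n, le_rfl⟩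
  have hzero : ν {ω | β F ω < β (⋃ n, (w n).1) ω} = 0 := by
    have h2 := ENNReal.Tendsto.const_mul hlim (a := 2) (Or.inr (by simp))
    rw [mul_zero] at h2
    exact le_antisymm (ge_of_tendsto' h2 hbound) bot_le
  filter_upwards [measure_eq_zero_iff_ae_notMem.1 hzero] with ω hω
  exact le_antisymm (hβ _ _ hsub ω) (not_lt.1 hω)

end Measure

section Dual

variable {X : Type u} [NormedAddCommGroup X] [NormedSpace ℝ X]

theorem Asplund.dense_differentiableAt (hX : Asplund X) {f : X → ℝ} (hf : Continuous f)
    (hconv : ConvexOn ℝ univ f) : Dense {x | DifferentiableAt ℝ f x} := by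
  intro x
  refine closure_mono ?_ (hX univ isOpen_univ convex_univ f hf.continuousOn hconv (mem_univ x))
  rintro y ⟨-, f', hf'⟩
  exact (hasFDerivWithinAt_univ.1 hf').differentiableAt

section SupportFunction

variable {Q : Set (X →L[ℝ] ℝ)} {R : ℝ}

theorem bddAbove_eval_image (hR : ∀ φ ∈ Q, ‖φ‖ ≤ R) (x : X) :
    BddAbove ((fun φ : X →L[ℝ] ℝ => φ x) '' Q) := by
  refine ⟨R * ‖x‖, ?_⟩
  rintro _ ⟨φ, hφ, rfl⟩
  exact (le_abs_self _).trans (φ.le_of_opNorm_le (hR φ hφ) x)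

theorem le_supp (hR : ∀ φ ∈ Q, ‖φ‖ ≤ R) {φ : X →L[ℝ] ℝ} (hφ : φ ∈ Q) (x : X) :
    φ x ≤ supp x Q :=
  le_csSup (bddAbove_eval_image hR x) ⟨φ, hφ, rfl⟩

theorem supp_le_s3 (hQ : Q.Nonempty) {x : X} {c : ℝ} (h : ∀ φ ∈ Q, φ x ≤ c) : supp x Q ≤ c :=
  csSup_le (hQ.image _) (by rintro _ ⟨φ, hφ, rfl⟩; exact h φ hφ)

theorem supp_le_add (hQ : Q.Nonempty) (hR : ∀ φ ∈ Q, ‖φ‖ ≤ R) (x y : X) :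
    supp x Q ≤ supp y Q + R * ‖x - y‖ := by
  refine supp_le_s3 hQ fun φ hφ => ?_
  have h1 := (le_abs_self _).trans (φ.le_of_opNorm_le (hR φ hφ) (x - y))
  have h2 := le_supp hR hφ y
  rw [map_sub] at h1
  linarith

theorem abs_supp_le_s3 (hQ : Q.Nonempty) (hR : ∀ φ ∈ Q, ‖φ‖ ≤ R) (x : X) :
    |supp x Q| ≤ R * ‖x‖ := by
  obtain ⟨φ, hφ⟩ := hQ
  have h1 := abs_le.1 (φ.le_of_opNorm_le (hR φ hφ) x)
  refine abs_le.2 ⟨h1.1.trans (le_supp hR hφ x), supp_le_s3 ⟨φ, hφ⟩ fun φ' hφ' => ?_⟩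
  exact (le_abs_self _).trans (φ'.le_of_opNorm_le (hR φ' hφ') x)

theorem supp_combo_le (hQ : Q.Nonempty) (hR : ∀ φ ∈ Q, ‖φ‖ ≤ R) (x y : X) {a b : ℝ}
    (ha : 0 ≤ a) (hb : 0 ≤ b) : supp (a • x + b • y) Q ≤ a * supp x Q + b * supp y Q := by
  refine supp_le_s3 hQ fun φ hφ => ?_
  rw [map_add, map_smul, map_smul, smul_eq_mul, smul_eq_mul]
  gcongr
  · exact le_supp hR hφ x
  · exact le_supp hR hφ y

theorem convexOn_supp_s3 (hQ : Q.Nonempty) (hR : ∀ φ ∈ Q, ‖φ‖ ≤ R) :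
    ConvexOn ℝ univ fun x : X => supp x Q :=
  ⟨convex_univ, fun x _ y _ _ _ ha hb _ => supp_combo_le hQ hR x y ha hb⟩

theorem continuous_supp (hQ : Q.Nonempty) (hR : ∀ φ ∈ Q, ‖φ‖ ≤ R) :
    Continuous fun x : X => supp x Q := by
  refine (LipschitzWith.of_le_add_mul R.toNNReal fun x y => ?_).continuous
  refine (supp_le_add hQ hR x y).trans ?_
  rw [dist_eq_norm]
  gcongr
  exact Real.le_coe_toNNReal R

end SupportFunction

/-- In the dual of an Asplund space, nonempty bounded sets have weak* slices of arbitrarily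
small diameter. -/
theorem Asplund.exists_small_slice (hX : Asplund X) {Q : Set (X →L[ℝ] ℝ)} (hQ : Q.Nonempty)
    {R : ℝ} (hR : ∀ φ ∈ Q, ‖φ‖ ≤ R) {ε : ℝ} (hε : 0 < ε) :
    ∃ (x : X) (c : ℝ), (∃ φ ∈ Q, c < φ x) ∧
      ∀ φ ∈ Q, ∀ φ' ∈ Q, c < φ x → c < φ' x → ∀ h, φ h - φ' h ≤ ε * ‖h‖ := by
  obtain ⟨x, hx⟩ :=
    (hX.dense_differentiableAt (continuous_supp hQ hR) (convexOn_supp_s3 hQ hR)).nonempty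
  set f' := fderiv ℝ (fun x : X => supp x Q) x with hf'
  have hd := hx.hasFDerivAt.isLittleO.def (c := ε / 4) (by positivity)
  obtain ⟨δ, hδ, hball⟩ := Metric.eventually_nhds_iff.1 hd
  set d := δ / 2 with hdd
  have hd0 : 0 < d := by positivity
  have key : ∀ φ ∈ Q, supp x Q - ε / 4 * d < φ x → ∀ k : X, ‖k‖ = d →
      φ k - f' k ≤ ε / 2 * d := by
    intro φ hφ hc k hk
    have h1 := hball (y := x + k) (by rw [dist_eq_norm, add_sub_cancel_left, hk]; linarith)
    rw [add_sub_cancel_left, hk] at h1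
    have h2 := (abs_le.1 h1).2
    have h3 := le_supp hR hφ (x + k)
    rw [map_add] at h3
    linarith
  refine ⟨x, supp x Q - ε / 4 * d, ?_, fun φ hφ φ' hφ' hc hc' h => ?_⟩
  · obtain ⟨_, ⟨φ, hφ, rfl⟩, h⟩ := exists_lt_of_lt_csSup (hQ.image fun φ : X →L[ℝ] ℝ => φ x)
      (show supp x Q - ε / 4 * d < _ from sub_lt_self _ (by positivity))
    exact ⟨φ, hφ, h⟩
  · by_cases h0 : h = 0
    · simp [h0]
    have hn : 0 < ‖h‖ := norm_pos_iff.2 h0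
    have hk : ‖(d / ‖h‖) • h‖ = d := by
      rw [norm_smul, Real.norm_of_nonneg (by positivity)]
      field_simp
    have h1 := key φ hφ hc _ hk
    have h2 := key φ' hφ' hc' (-((d / ‖h‖) • h)) (by rw [norm_neg, hk])
    simp only [map_neg, map_smul, smul_eq_mul] at h1 h2
    have h3 : d / ‖h‖ * (φ h - φ' h) ≤ ε * d := by linarith
    rw [div_mul_eq_mul_div, div_le_iff₀ hn] at h3
    have h4 : d * (φ h - φ' h) ≤ d * (ε * ‖h‖) := by linarith
    exact le_of_mul_le_mul_left h4 hd0

/-- Weak* compact bounded sets in the dual of an Asplund space carry an ordinal-valued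
upper semicontinuous rank whose level sets have small diameter. -/
theorem Asplund.exists_rank (hX : Asplund X) {K : Set (WeakDual ℝ X)} (hK : IsClosed K)
    {R : ℝ} (hR : ∀ φ ∈ K, ‖WeakDual.toStrongDual φ‖ ≤ R) {ε : ℝ} (hε : 0 < ε) :
    ∃ r : WeakDual ℝ X → Ordinal.{u}, (∀ ξ, IsClosed {φ | φ ∈ K ∧ ξ ≤ r φ}) ∧
      ∀ φ ∈ K, ∀ φ' ∈ K, r φ = r φ' → ∀ h, φ h - φ' h ≤ ε * ‖h‖ := by
  have hslice : ∀ Q : Set (WeakDual ℝ X), ∃ W : Set (WeakDual ℝ X), IsOpen W ∧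
      (Q ⊆ K → Q.Nonempty → (Q ∩ W).Nonempty ∧
        ∀ φ ∈ Q ∩ W, ∀ φ' ∈ Q ∩ W, ∀ h, φ h - φ' h ≤ ε * ‖h‖) := by
    intro Q
    by_cases hQ : Q ⊆ K ∧ Q.Nonempty
    · obtain ⟨x, c, ⟨φ, hφ, hcφ⟩, hd⟩ := hX.exists_small_slice
        (Q := WeakDual.toStrongDual '' Q) (hQ.2.image _)
        (by rintro _ ⟨φ, hφ, rfl⟩; exact hR φ (hQ.1 hφ)) hε
      obtain ⟨φ, hφ, rfl⟩ := hφ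
      refine ⟨{φ | c < φ x}, isOpen_lt continuous_const (WeakDual.eval_continuous x),
        fun _ _ => ⟨⟨φ, hφ, hcφ⟩, ?_⟩⟩
      rintro φ ⟨hφ, hc⟩ φ' ⟨hφ', hc'⟩ h
      exact hd _ ⟨φ, hφ, rfl⟩ _ ⟨φ', hφ', rfl⟩ hc hc' h
    · exact ⟨∅, isOpen_empty, fun h1 h2 => absurd ⟨h1, h2⟩ hQ⟩
  choose slice hopen hsl using hslice
  let W : Ordinal.{u} → Set (WeakDual ℝ X) := wellFounded_lt.fix fun ξ ih =>
    slice (K \ ⋃ η : Iio ξ, ih η.1 η.2)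
  have hW : ∀ ξ, W ξ = slice (K \ ⋃ η : Iio ξ, W η.1) := fun ξ =>
    wellFounded_lt.fix_eq _ ξ
  have hWo : ∀ ξ, IsOpen (W ξ) := fun ξ => by rw [hW]; exact hopen _
  have hex : ∃ ξ, ¬ (K \ ⋃ η : Iio ξ, W η.1).Nonempty := by
    by_contra! hne
    have hmem : ∀ ξ, ((K \ ⋃ η : Iio ξ, W η.1) ∩ W ξ).Nonempty := fun ξ => by
      have := (hsl (K \ ⋃ η : Iio ξ, W η.1) sdiff_subset (hne ξ)).1
      rwa [← hW ξ] at this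
    choose p hp using hmem
    refine not_injective_of_ordinal p fun ξ η h => ?_
    have hlt : ∀ ξ η, ξ < η → p ξ ≠ p η := fun ξ η hlt heq =>
      (hp η).1.2 (mem_iUnion.2 ⟨⟨ξ, hlt⟩, heq ▸ (hp ξ).2⟩)
    rcases lt_trichotomy ξ η with h' | h' | h'
    · exact absurd h (hlt _ _ h')
    · exact h'
    · exact absurd h.symm (hlt _ _ h')
  obtain ⟨ξ₀, hξ₀⟩ := hex
  have hcov : ∀ φ ∈ K, {η | φ ∈ W η}.Nonempty := by
    intro φ hφ
    by_contra hne
    refine hξ₀ ⟨φ, hφ, fun hmem => ?_⟩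
    obtain ⟨η, hη⟩ := mem_iUnion.1 hmem
    exact hne ⟨η.1, hη⟩
  have hr : ∀ φ ∈ K, ∀ ξ, ξ ≤ sInf {η | φ ∈ W η} ↔ φ ∉ ⋃ η : Iio ξ, W η.1 := by
    intro φ hφ ξ
    constructor
    · intro hle hmem
      obtain ⟨η, hη⟩ := mem_iUnion.1 hmem
      exact absurd (hle.trans (csInf_le' hη)) (not_le.2 η.2)
    · intro hmem
      by_contra hlt
      exact hmem (mem_iUnion.2 ⟨⟨_, not_le.1 hlt⟩, csInf_mem (hcov φ hφ)⟩)
  refine ⟨fun φ => sInf {η | φ ∈ W η}, fun ξ => ?_, fun φ hφ φ' hφ' heq => ?_⟩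
  · have : {φ | φ ∈ K ∧ ξ ≤ sInf {η | φ ∈ W η}} = K ∩ (⋃ η : Iio ξ, W η.1)ᶜ := by
      ext φ
      exact and_congr_right fun hφ => hr φ hφ ξ
    rw [this]
    exact hK.inter (isOpen_iUnion fun η => hWo _).isClosed_compl
  · have hin : ∀ φ ∈ K, φ ∈ (K \ ⋃ η : Iio (sInf {η | φ ∈ W η}), W η.1) ∩
        W (sInf {η | φ ∈ W η}) := fun φ hφ =>
      ⟨⟨hφ, (hr φ hφ _).1 le_rfl⟩, csInf_mem (hcov φ hφ)⟩
    have h1 := hin φ hφ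
    have h2 := hin φ' hφ'
    have heq' : sInf {η | φ ∈ W η} = sInf {η | φ' ∈ W η} := heq
    rw [← heq'] at h2
    generalize sInf {η | φ ∈ W η} = ξ at h1 h2
    rw [hW ξ] at h1 h2
    exact (hsl _ sdiff_subset ⟨φ, h1.1⟩).2 φ h1 φ' h2

theorem exists_mem_forall_eq_of_finset {K : Set (WeakDual ℝ X)} (hK : IsCompact K) {a : X → ℝ}
    {S : Set X} (h : ∀ F : Finset S, ∃ φ ∈ K, ∀ x ∈ F, φ x = a x) :
    ∃ φ ∈ K, ∀ x ∈ S, φ x = a x := by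
  classical
  have hcl : ∀ F : Finset S, IsClosed {φ : WeakDual ℝ X | ∀ x ∈ F, φ x = a x} := fun F => by
    simp only [ofPred_forall]
    exact isClosed_biInter fun x _ =>
      isClosed_eq (WeakDual.eval_continuous (x : X)) continuous_const
  obtain ⟨φ, hφ⟩ := IsCompact.nonempty_iInter_of_directed_nonempty_isCompact_isClosed
    (fun F : Finset S => K ∩ {φ : WeakDual ℝ X | ∀ x ∈ F, φ x = a x})
    (fun F G => ⟨F ∪ G, fun φ hφ => ⟨hφ.1, fun x hx => hφ.2 x (Finset.mem_union_left _ hx)⟩,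
      fun φ hφ => ⟨hφ.1, fun x hx => hφ.2 x (Finset.mem_union_right _ hx)⟩⟩)
    (fun F => h F) (fun F => hK.inter_right (hcl F)) (fun F => hK.isClosed.inter (hcl F))
  rw [mem_iInter] at hφ
  exact ⟨φ, (hφ ∅).1, fun x hx => (hφ {⟨x, hx⟩}).2 ⟨x, hx⟩ (Finset.mem_singleton_self _)⟩

end Dual

section Selection

variable {X : Type u} [NormedAddCommGroup X] [NormedSpace ℝ X]
variable {Ω : Type v} [MeasurableSpace Ω]

/-- For almost every `ω`, any prescribed countable part of the function `u · ω` is interpolated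
by an element of `K ω`. -/
def CountablyInterpolable (ν : Measure Ω) (u : X → Ω → ℝ) (K : Ω → Set (WeakDual ℝ X)) : Prop :=
  ∀ F : Set X, F.Countable → ∀ᵐ ω ∂ν, ∃ φ ∈ K ω, ∀ x ∈ F, φ x = u x ω

theorem CountablyInterpolable.of_finset {ν : Measure Ω} {u : X → Ω → ℝ}
    {K : Ω → Set (WeakDual ℝ X)} (hK : ∀ ω, IsCompact (K ω))
    (h : ∀ F : Finset X, ∀ᵐ ω ∂ν, ∃ φ ∈ K ω, ∀ x ∈ F, φ x = u x ω) :
    CountablyInterpolable ν u K := by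
  classical
  intro F hF
  have := hF.to_subtype
  have h' : ∀ᵐ ω ∂ν, ∀ G : Finset F, ∃ φ ∈ K ω, ∀ x ∈ G.image Subtype.val, φ x = u x ω :=
    ae_all_iff.2 fun G => h _
  filter_upwards [h'] with ω hω
  refine exists_mem_forall_eq_of_finset (hK ω) fun G => ?_
  obtain ⟨φ, hφ, hG⟩ := hω G
  exact ⟨φ, hφ, fun x hx => hG x (Finset.mem_image_of_mem _ hx)⟩

theorem isClosed_forall_eval_eq (a : X → ℝ) (F : Set X) :
    IsClosed {φ : WeakDual ℝ X | ∀ x ∈ F, φ x = a x} := by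
  simp only [ofPred_forall]
  exact isClosed_biInter fun x _ => isClosed_eq (WeakDual.eval_continuous x) continuous_const

theorem CountablyInterpolable.exists_small_diam {ν : Measure Ω} [IsFiniteMeasure ν]
    (hX : Asplund X) (hν : ∀ A, NullMeasurableSet A ν) {u : X → Ω → ℝ}
    {K : Ω → Set (WeakDual ℝ X)} (hK : ∀ ω, IsCompact (K ω))
    (hR : ∀ ω, ∃ R, ∀ φ ∈ K ω, ‖WeakDual.toStrongDual φ‖ ≤ R)
    (hu : CountablyInterpolable ν u K) {ε : ℝ} (hε : 0 < ε) :
    ∃ K' : Ω → Set (WeakDual ℝ X), (∀ ω, K' ω ⊆ K ω) ∧ (∀ ω, IsCompact (K' ω)) ∧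
      CountablyInterpolable ν u K' ∧
      ∀ ω, ∀ φ ∈ K' ω, ∀ φ' ∈ K' ω, ∀ h, φ h - φ' h ≤ ε * ‖h‖ := by
  have hr := fun ω => hX.exists_rank (hK ω).isClosed (hR ω).choose_spec hε
  choose r hrc hr using hr
  set E : Set X → Ω → Set (WeakDual ℝ X) :=
    fun F ω => {φ | φ ∈ K ω ∧ ∀ x ∈ F, φ x = u x ω} with hE
  have hEc : ∀ F ω, IsCompact (E F ω) := fun F ω =>
    (hK ω).inter_right (isClosed_forall_eval_eq (fun x => u x ω) F)
  have hbdd : ∀ F ω, BddAbove (r ω '' E F ω) := fun F ω => Ordinal.bddAbove_of_small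
  have hEanti : ∀ F G, F ⊆ G → ∀ ω, E G ω ⊆ E F ω := fun F G hFG ω φ hφ =>
    ⟨hφ.1, fun x hx => hφ.2 x (hFG hx)⟩
  set β : Set X → Ω → Ordinal.{u} := fun F ω => sSup (r ω '' E F ω) with hβ
  obtain ⟨F₀, hF₀, hstab⟩ := exists_countable_ae_stable hν (β := β) fun F G hFG ω =>
    csSup_le_csSup' (hbdd F ω) (image_mono (hEanti F G hFG ω))
  have hle : ∀ F ω, ∀ φ ∈ E F ω, r ω φ ≤ β F ω := fun F ω φ hφ =>
    le_csSup (hbdd F ω) (mem_image_of_mem _ hφ)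
  refine ⟨fun ω => E F₀ ω ∩ {φ | φ ∈ K ω ∧ β F₀ ω ≤ r ω φ}, fun ω φ hφ => hφ.1.1,
    fun ω => (hEc F₀ ω).inter_right (hrc ω _), fun F hF => ?_, ?_⟩
  · filter_upwards [hstab (F ∪ F₀) (hF.union hF₀) subset_union_right,
      hu (F ∪ F₀) (hF.union hF₀)] with ω h1 h2
    have hne : (E (F ∪ F₀) ω).Nonempty := by
      obtain ⟨φ, hφ⟩ := h2
      exact ⟨φ, hφ⟩
    have husc : UpperSemicontinuousOn (r ω) (E (F ∪ F₀) ω) := by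
      refine upperSemicontinuousOn_iff_preimage_Ici.2 fun ξ => ⟨_, hrc ω ξ, ?_⟩
      ext φ
      exact ⟨fun h => ⟨h.1, h.1.1, h.2⟩, fun h => ⟨h.1, h.2.2⟩⟩
    obtain ⟨φ, hφ, hmax⟩ := husc.exists_isMaxOn hne (hEc _ ω)
    refine ⟨φ, ⟨hEanti _ _ subset_union_right ω hφ, hφ.1, ?_⟩,
      fun x hx => hφ.2 x (Or.inl hx)⟩
    rw [← h1]
    refine csSup_le (hne.image _) ?_
    rintro _ ⟨φ', hφ', rfl⟩
    exact hmax hφ'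
  · rintro ω φ ⟨hφ, -, hφr⟩ φ' ⟨hφ', -, hφr'⟩
    exact hr ω φ hφ.1 φ' hφ'.1
      (((hle _ ω φ hφ).antisymm hφr).trans ((hle _ ω φ' hφ').antisymm hφr').symm)

/-- If every set is measurable, then a countably interpolable family is represented by
a single selector. -/
theorem CountablyInterpolable.exists_selector_of_total {ν : Measure Ω} [IsFiniteMeasure ν]
    (hX : Asplund X) (hν : ∀ A, NullMeasurableSet A ν) {u : X → Ω → ℝ}
    {K : Ω → Set (WeakDual ℝ X)} (hK : ∀ ω, IsCompact (K ω))
    (hR : ∀ ω, ∃ R, ∀ φ ∈ K ω, ‖WeakDual.toStrongDual φ‖ ≤ R)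
    (hu : CountablyInterpolable ν u K) :
    ∃ f : Ω → WeakDual ℝ X, (∀ᵐ ω ∂ν, f ω ∈ K ω) ∧ ∀ x, ∀ᵐ ω ∂ν, f ω x = u x ω := by
  classical
  let T := {L : Ω → Set (WeakDual ℝ X) // (∀ ω, L ω ⊆ K ω) ∧ (∀ ω, IsCompact (L ω)) ∧
    CountablyInterpolable ν u L}
  have hstep : ∀ (n : ℕ) (L : T), ∃ L' : T, (∀ ω, L'.1 ω ⊆ L.1 ω) ∧
      ∀ ω, ∀ φ ∈ L'.1 ω, ∀ φ' ∈ L'.1 ω, ∀ h, φ h - φ' h ≤ 1 / ((n : ℝ) + 1) * ‖h‖ := by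
    rintro n ⟨L, hL, hLc, hLu⟩
    obtain ⟨L', h1, h2, h3, h4⟩ := hLu.exists_small_diam hX hν hLc
      (fun ω => (hR ω).imp fun R h φ hφ => h φ (hL ω hφ)) (Nat.one_div_pos_of_nat (α := ℝ) (n := n))
    exact ⟨⟨L', fun ω => (h1 ω).trans (hL ω), h2, h3⟩, h1, h4⟩
  choose next hnext hdiam using hstep
  let L : ℕ → T := fun n => Nat.rec ⟨K, fun _ => subset_rfl, hK, hu⟩ next n
  have hLs : ∀ n, L (n + 1) = next n (L n) := fun n => rfl
  have hne : ∀ᵐ ω ∂ν, ∀ n, ((L n).1 ω).Nonempty := by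
    refine ae_all_iff.2 fun n => ?_
    filter_upwards [(L n).2.2.2 ∅ countable_empty] with ω hω
    exact hω.imp fun φ h => h.1
  have hf : ∀ ω, ∃ φ : WeakDual ℝ X, (∀ n, ((L n).1 ω).Nonempty) → ∀ n, φ ∈ (L n).1 ω := by
    intro ω
    by_cases h : ∀ n, ((L n).1 ω).Nonempty
    · obtain ⟨φ, hφ⟩ := IsCompact.nonempty_iInter_of_sequence_nonempty_isCompact_isClosed
        (fun n => (L n).1 ω) (fun n => by rw [hLs]; exact hnext n _ ω) h ((L 0).2.2.1 ω)
        (fun n => ((L n).2.2.1 ω).isClosed)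
      exact ⟨φ, fun _ => mem_iInter.1 hφ⟩
    · exact ⟨0, fun h' => absurd h' h⟩
  choose f hf using hf
  refine ⟨f, ?_, fun x => ?_⟩
  · filter_upwards [hne] with ω hω
    exact hf ω hω 0
  · have hx : ∀ᵐ ω ∂ν, ∀ n, ∃ φ ∈ (L n).1 ω, ∀ y ∈ ({x} : Set X), φ y = u y ω :=
      ae_all_iff.2 fun n => (L n).2.2.2 {x} (countable_singleton x)
    filter_upwards [hne, hx] with ω hω hxω
    have hlim : Tendsto (fun n : ℕ => 1 / ((n : ℝ) + 1) * ‖x‖) atTop (𝓝 (0 * ‖x‖)) :=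
      tendsto_one_div_add_atTop_nhds_zero_nat.mul_const _
    rw [zero_mul] at hlim
    refine le_antisymm (sub_nonpos.1 (ge_of_tendsto' hlim fun n => ?_))
      (sub_nonpos.1 (ge_of_tendsto' hlim fun n => ?_))
    all_goals
      obtain ⟨φ, hφ, hφx⟩ := hxω (n + 1)
      rw [hLs] at hφ
      have hfm := hf ω hω (n + 1)
      rw [hLs] at hfm
      rw [← hφx x rfl]
    · exact hdiam n _ ω _ hfm _ hφ x
    · exact hdiam n _ ω _ hφ _ hfm x

end Selection

section SelectionComplete

variable {X : Type u} [NormedAddCommGroup X]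
variable {Ω : Type v} [MeasurableSpace Ω]

theorem exists_dense_subset_ball (X : Type u) [NormedAddCommGroup X] :
    ∃ D : Set X, D ⊆ ball (0 : X) 1 ∧ ball (0 : X) 1 ⊆ closure D ∧
      Cardinal.mk ↥D = densCard X :=
  csInf_mem (s := {c : Cardinal.{u} |
    ∃ D : Set X, D ⊆ ball (0 : X) 1 ∧ ball (0 : X) 1 ⊆ closure D ∧ Cardinal.mk ↥D = c})
    ⟨_, ball 0 1, subset_rfl, subset_closure, rfl⟩

theorem DensLtAdditivity.measurableSet_iUnion {μ : Measure Ω} (hcomp : μ.IsComplete)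
    (hdens : DensLtAdditivity X μ) {D : Set X} (hD : Cardinal.mk D = densCard X)
    (N : Finset D × ℕ → Set Ω) (hN : ∀ i, μ (N i) = 0) : MeasurableSet (⋃ i, N i) := by
  have hNm : ∀ i, MeasurableSet (N i) := fun i => hcomp.out' _ (hN i)
  rcases finite_or_infinite D with hfin | hinf
  · exact MeasurableSet.iUnion hNm
  · rw [← sUnion_range]
    refine hdens (range N) (by rintro _ ⟨i, rfl⟩; exact ⟨hNm i, hN i⟩) ?_
    refine Cardinal.mk_range_le_lift.trans ?_
    rw [Cardinal.lift_le, Cardinal.mk_prod, Cardinal.mk_finset_of_infinite, ← hD]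
    simp [Cardinal.aleph0_le_mk]

variable [NormedSpace ℝ X]

theorem CountablyInterpolable.exists_selector {μ : Measure Ω} [IsFiniteMeasure μ]
    (hcomp : μ.IsComplete) (hX : Asplund X) (hdens : DensLtAdditivity X μ) {u : X → Ω → ℝ}
    {K : Ω → Set (WeakDual ℝ X)} (hK : ∀ ω, IsCompact (K ω))
    (hR : ∀ ω, ∃ R, ∀ φ ∈ K ω, ‖WeakDual.toStrongDual φ‖ ≤ R)
    (hu : CountablyInterpolable μ u K) :
    ∃ f : Ω → WeakDual ℝ X, (∀ᵐ ω ∂μ, f ω ∈ K ω) ∧ ∀ x, ∀ᵐ ω ∂μ, f ω x = u x ω := by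
  classical
  obtain ⟨D, hDb, hDd, hDc⟩ := exists_dense_subset_ball X
  let e : Finset D × ℕ ≃ ℕ × (Finset D × ℕ) :=
    ((Equiv.prodCongrRight fun _ => Nat.pairEquiv.symm).trans
      (Equiv.prodAssoc _ _ _).symm).trans (Equiv.prodComm _ _)
  obtain ⟨Z, hZ, hZt, hZN⟩ := exists_total_part (μ := μ) e
    fun N hN => hdens.measurableSet_iUnion hcomp hDc N hN
  obtain ⟨f₁, hf₁K, hf₁⟩ := CountablyInterpolable.exists_selector_of_total (ν := μ.restrict Z)
    (u := u) (K := K) hX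
    (fun A => (nullMeasurableSet_restrict hZ.nullMeasurableSet).2
      (hZt (A ∩ Z) inter_subset_right).nullMeasurableSet)
    hK hR fun F hF => ae_restrict_of_ae (hu F hF)
  let N : Finset D × ℕ → Set Ω :=
    fun p => {ω | ¬ ∃ φ ∈ K ω, ∀ x ∈ p.1.image Subtype.val, φ x = u x ω}
  have hN : ∀ p, μ (N p) = 0 := fun p => hu _ (Finset.countable_toSet _)
  have hgood : ∀ᵐ ω ∂μ, ω ∉ Z → ∃ φ ∈ K ω, ∀ x ∈ D, φ x = u x ω := by
    have h0 := hZN N hN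
    filter_upwards [measure_eq_zero_iff_ae_notMem.1 h0] with ω hω hωZ
    refine exists_mem_forall_eq_of_finset (hK ω) fun G => ?_
    by_contra hG
    refine hω ⟨mem_iUnion.2 ⟨(G, 0), ?_⟩, hωZ⟩
    rintro ⟨φ, hφ, hφG⟩
    exact hG ⟨φ, hφ, fun x hx => hφG x (Finset.mem_image_of_mem _ hx)⟩
  have hf₂ : ∀ ω, ∃ φ : WeakDual ℝ X, (∃ φ ∈ K ω, ∀ x ∈ D, φ x = u x ω) →
      φ ∈ K ω ∧ ∀ x ∈ D, φ x = u x ω := by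
    intro ω
    by_cases h : ∃ φ ∈ K ω, ∀ x ∈ D, φ x = u x ω
    · exact ⟨h.choose, fun _ => h.choose_spec⟩
    · exact ⟨0, fun h' => absurd h' h⟩
  choose f₂ hf₂ using hf₂
  refine ⟨Z.piecewise f₁ f₂, ?_, fun x => ?_⟩
  · filter_upwards [hgood, (ae_restrict_iff' hZ).1 hf₁K] with ω h2 h1
    by_cases hω : ω ∈ Z
    · rw [piecewise_eq_of_mem _ _ _ hω]
      exact h1 hω
    · rw [piecewise_eq_of_notMem _ _ _ hω]
      exact (hf₂ ω (h2 hω)).1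
  · obtain ⟨c, y, hy, rfl⟩ : ∃ (c : ℝ) (y : X), y ∈ ball (0 : X) 1 ∧ x = c • y := by
      have hpos : 0 < ‖x‖ + 1 := by positivity
      refine ⟨‖x‖ + 1, (‖x‖ + 1)⁻¹ • x, ?_, (smul_inv_smul₀ hpos.ne' x).symm⟩
      rw [mem_ball_zero_iff, norm_smul, norm_inv, Real.norm_of_nonneg hpos.le, inv_mul_lt_iff₀ hpos]
      linarith
    obtain ⟨d, hd, hdy⟩ := mem_closure_iff_seq_limit.1 (hDd hy)
    filter_upwards [hgood, (ae_restrict_iff' hZ).1 (hf₁ (c • y)),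
      hu (insert (c • y) (range d)) ((countable_range d).insert _)] with ω h2 h1 h3
    by_cases hω : ω ∈ Z
    · rw [piecewise_eq_of_mem _ _ _ hω]
      exact h1 hω
    · rw [piecewise_eq_of_notMem _ _ _ hω]
      obtain ⟨φ, -, hφ⟩ := h3
      rw [← hφ _ (mem_insert _ _), map_smul, map_smul]
      congr 1
      refine tendsto_nhds_unique (((map_continuous (f₂ ω)).tendsto y).comp hdy)
        ((((map_continuous φ).tendsto y).comp hdy).congr fun n => ?_)
      exact (hφ _ (mem_insert_of_mem _ ⟨n, rfl⟩)).trans ((hf₂ ω (h2 hω)).2 _ (hd n)).symm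

end SelectionComplete

section WeakStar

variable {X : Type u} [NormedAddCommGroup X] [NormedSpace ℝ X]

theorem wstar_mem_image {Q : Set (X →L[ℝ] ℝ)} {φ : X →L[ℝ] ℝ} : wstar φ ∈ wstar '' Q ↔ φ ∈ Q :=
  ⟨by rintro ⟨φ', h, rfl⟩; exact h, mem_image_of_mem _⟩

theorem exists_lt_eval_of_notMem {S : Set (WeakDual ℝ X)} (hS : Convex ℝ S) (hcl : IsClosed S)
    {g : WeakDual ℝ X} (hg : g ∉ S) : ∃ (x : X) (c : ℝ), (∀ φ ∈ S, φ x < c) ∧ c < g x := by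
  have : LocallyConvexSpace ℝ (WeakDual ℝ X) :=
    WeakBilin.locallyConvexSpace (B := topDualPairing ℝ X)
  obtain ⟨f, c, h1, h2⟩ := geometric_hahn_banach_closed_point hS hcl hg
  obtain ⟨x, rfl⟩ := LinearMap.dualEmbedding_surjective (topDualPairing ℝ X) f
  exact ⟨x, c, h1, h2⟩

theorem convex_wstar_le (p : X → ℝ) :
    Convex ℝ (wstar '' {φ : X →L[ℝ] ℝ | ∀ x, φ x ≤ p x}) := by
  rintro _ ⟨φ, hφ, rfl⟩ _ ⟨φ', hφ', rfl⟩ a b ha hb hab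
  refine ⟨a • φ + b • φ', fun x => ?_, rfl⟩
  calc a * φ x + b * φ' x ≤ a * p x + b * p x := by gcongr; exacts [hφ x, hφ' x]
    _ = p x := by rw [← add_mul, hab, one_mul]

theorem isClosed_wstar_le (p : X → ℝ) :
    IsClosed (wstar '' {φ : X →L[ℝ] ℝ | ∀ x, φ x ≤ p x}) := by
  have : wstar '' {φ : X →L[ℝ] ℝ | ∀ x, φ x ≤ p x} = {φ : WeakDual ℝ X | ∀ x, φ x ≤ p x} :=
    image_id _
  rw [this]
  simp only [ofPred_forall]
  exact isClosed_iInter fun x => isClosed_le (WeakDual.eval_continuous x) continuous_const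

theorem isCompact_wstar_image {Q : Set (X →L[ℝ] ℝ)} (hcl : WStarClosed Q) {R : ℝ}
    (hR : ∀ φ ∈ Q, ‖φ‖ ≤ R) : IsCompact (wstar '' Q) := by
  refine (WeakDual.isCompact_closedBall (𝕜 := ℝ) (0 : X →L[ℝ] ℝ) R).of_isClosed_subset hcl ?_
  rintro _ ⟨φ, hφ, rfl⟩
  exact mem_closedBall_zero_iff.2 (hR φ hφ)

theorem exists_eq_supp {Q : Set (X →L[ℝ] ℝ)} (hQ : Q.Nonempty) (hcl : WStarClosed Q) {R : ℝ}
    (hR : ∀ φ ∈ Q, ‖φ‖ ≤ R) (x : X) : ∃ φ ∈ Q, φ x = supp x Q := by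
  obtain ⟨_, ⟨φ, hφ, rfl⟩, hmax⟩ := (isCompact_wstar_image hcl hR).exists_isMaxOn (hQ.image _)
    (WeakDual.eval_continuous x).continuousOn
  exact ⟨φ, hφ, (le_supp hR hφ x).antisymm (supp_le_s3 hQ fun φ' hφ' => hmax ⟨φ', hφ', rfl⟩)⟩

theorem norm_le_of_le_supp {Q : Set (X →L[ℝ] ℝ)} (hQ : Q.Nonempty) {R : ℝ}
    (hR : ∀ φ ∈ Q, ‖φ‖ ≤ R) {φ : X →L[ℝ] ℝ} (hφ : ∀ x, φ x ≤ supp x Q) : ‖φ‖ ≤ R := by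
  have hR0 : 0 ≤ R := hQ.elim fun φ' h => (norm_nonneg φ').trans (hR φ' h)
  refine φ.opNorm_le_bound hR0 fun x => abs_le.2 ⟨?_, ?_⟩
  · have h1 := (hφ (-x)).trans ((le_abs_self _).trans (abs_supp_le_s3 hQ hR (-x)))
    rw [map_neg, norm_neg] at h1
    linarith
  · exact (hφ x).trans ((le_abs_self _).trans (abs_supp_le_s3 hQ hR x))

theorem mem_wstarClosedConvexHull_iff {Q : Set (X →L[ℝ] ℝ)} (hQ : Q.Nonempty) {R : ℝ}
    (hR : ∀ φ ∈ Q, ‖φ‖ ≤ R) {φ : X →L[ℝ] ℝ} :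
    φ ∈ wstarClosedConvexHull Q ↔ ∀ x, φ x ≤ supp x Q := by
  constructor
  · intro h
    have hsub : closure (convexHull ℝ (wstar '' Q)) ⊆
        wstar '' {φ : X →L[ℝ] ℝ | ∀ x, φ x ≤ supp x Q} :=
      closure_minimal (convexHull_min (image_mono fun φ hφ x => le_supp hR hφ x)
        (convex_wstar_le _)) (isClosed_wstar_le _)
    exact wstar_mem_image.1 (hsub h)
  · intro h
    by_contra hφ
    obtain ⟨x, c, h1, h2⟩ := exists_lt_eval_of_notMem (convex_convexHull ℝ (wstar '' Q)).closure
      isClosed_closure hφ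
    refine absurd h2 (not_lt.2 ((h x).trans (supp_le_s3 hQ fun φ' hφ' => ?_)))
    exact (h1 _ (subset_closure (subset_convexHull ℝ _ ⟨φ', hφ', rfl⟩))).le

end WeakStar

theorem mem_closure_of_forall_finset {X : Type u} [NormedAddCommGroup X] [NormedSpace ℝ X]
    {S : Set (WeakDual ℝ X)} {g : WeakDual ℝ X}
    (h : ∀ (F : Finset X) (ε : ℝ), 0 < ε → ∃ φ ∈ S, ∀ x ∈ F, |φ x - g x| < ε) :
    g ∈ closure S := by
  classical
  have h' : ∀ p : Finset X × ℕ, ∃ φ ∈ S, ∀ x ∈ p.1, |φ x - g x| < 1 / ((p.2 : ℝ) + 1) :=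
    fun p => h p.1 _ Nat.one_div_pos_of_nat
  choose φ hφS hφ using h'
  have hlim : Tendsto φ atTop (𝓝 g) := by
    refine (WeakBilin.tendsto_iff_forall_eval_tendsto (topDualPairing ℝ X)
      (fun a b hab => ContinuousLinearMap.ext fun x => LinearMap.congr_fun hab x)).2 fun x => ?_
    refine tendsto_iff_norm_sub_tendsto_zero.2 ?_
    have h1 : Tendsto (fun p : Finset X × ℕ => 1 / ((p.2 : ℝ) + 1)) atTop (𝓝 0) :=
      tendsto_one_div_add_atTop_nhds_zero_nat.comp
        (prod_atTop_atTop_eq (α := Finset X) (β := ℕ) ▸ tendsto_snd)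
    refine squeeze_zero' (Eventually.of_forall fun _ => norm_nonneg _) ?_ h1
    filter_upwards [eventually_ge_atTop (({x} : Finset X), 0)] with p hp
    exact (hφ p x (hp.1 (Finset.mem_singleton_self x))).le
  exact mem_closure_of_tendsto hlim (Eventually.of_forall hφS)

/-- A function squeezed between measurable lower and upper bounds with arbitrarily small
integral gap is almost everywhere measurable. -/
theorem aestronglyMeasurable_of_squeeze {Ω : Type v} [MeasurableSpace Ω] {μ : Measure Ω}
    {h : Ω → ℝ} {l r : ℕ → Ω → ℝ} (hl : ∀ n, Measurable (l n)) (hr : ∀ n, Measurable (r n))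
    (hi : ∀ n, Integrable (fun ω => r n ω - l n ω) μ) (hlh : ∀ n ω, l n ω ≤ h ω)
    (hhr : ∀ n ω, h ω ≤ r n ω)
    (hlim : Tendsto (fun n => ∫ ω, (r n ω - l n ω) ∂μ) atTop (𝓝 0)) :
    AEStronglyMeasurable h μ := by
  have hL : Measurable fun ω => ⨆ n, l n ω := Measurable.iSup hl
  have hU : Measurable fun ω => ⨅ n, r n ω := Measurable.iInf hr
  have hlb : ∀ ω, BddAbove (range fun n => l n ω) := fun ω =>
    ⟨h ω, by rintro _ ⟨n, rfl⟩; exact hlh n ω⟩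
  have hrb : ∀ ω, BddBelow (range fun n => r n ω) := fun ω =>
    ⟨h ω, by rintro _ ⟨n, rfl⟩; exact hhr n ω⟩
  have hLh : ∀ ω, ⨆ n, l n ω ≤ h ω := fun ω => ciSup_le fun n => hlh n ω
  have hhU : ∀ ω, h ω ≤ ⨅ n, r n ω := fun ω => le_ciInf fun n => hhr n ω
  have hle : ∀ n ω, (⨅ n, r n ω) - ⨆ n, l n ω ≤ r n ω - l n ω := fun n ω =>
    sub_le_sub (ciInf_le (hrb ω) n) (le_ciSup (hlb ω) n)
  have hnn : ∀ ω, 0 ≤ (⨅ n, r n ω) - ⨆ n, l n ω := fun ω =>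
    sub_nonneg.2 ((hLh ω).trans (hhU ω))
  have hint : Integrable (fun ω => (⨅ n, r n ω) - ⨆ n, l n ω) μ :=
    (hi 0).mono' (hU.sub hL).aestronglyMeasurable (Eventually.of_forall fun ω => by
      rw [Real.norm_of_nonneg (hnn ω)]; exact hle 0 ω)
  have h0 : ∫ ω, ((⨅ n, r n ω) - ⨆ n, l n ω) ∂μ = 0 :=
    le_antisymm (ge_of_tendsto' hlim fun n => integral_mono hint (hi n) (hle n))
      (integral_nonneg hnn)
  rw [integral_eq_zero_iff_of_nonneg hnn hint] at h0
  refine ⟨_, hL.stronglyMeasurable, ?_⟩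
  filter_upwards [h0] with ω hω
  have : (⨅ n, r n ω) - ⨆ n, l n ω = 0 := hω
  have h1 := hLh ω
  have h2 := hhU ω
  linarith

section GelfandIntegral

variable {X : Type u} [NormedAddCommGroup X] [NormedSpace ℝ X]
variable {Ω : Type v} [MeasurableSpace Ω] {μ : Measure Ω}

theorem gelfandIntegrable_of_norm_le {f : Ω → X →L[ℝ] ℝ} {ψ : Ω → ℝ} (hψ : Integrable ψ μ)
    (hf : ∀ x, AEStronglyMeasurable (fun ω => f ω x) μ) (hb : ∀ᵐ ω ∂μ, ‖f ω‖ ≤ ψ ω) :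
    GelfandIntegrable μ f := by
  have hle : ∀ x, ∀ᵐ ω ∂μ, ‖f ω x‖ ≤ ψ ω * ‖x‖ := fun x => by
    filter_upwards [hb] with ω hω using (f ω).le_of_opNorm_le hω x
  have hi : ∀ x, Integrable (fun ω => f ω x) μ := fun x => (hψ.mul_const ‖x‖).mono' (hf x) (hle x)
  refine ⟨hi, LinearMap.mkContinuous
    { toFun := fun x => ∫ ω, f ω x ∂μ
      map_add' := fun x y => by simp_rw [map_add]; exact integral_add (hi x) (hi y)
      map_smul' := fun c x => by simp_rw [map_smul]; exact integral_smul c _ }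
    (∫ ω, ψ ω ∂μ) fun x => ?_, fun x => rfl⟩
  refine (norm_integral_le_of_norm_le (hψ.mul_const ‖x‖) (hle x)).trans_eq ?_
  rw [integral_mul_const]

variable {Γ : Ω → Set (X →L[ℝ] ℝ)} {ψ : Ω → ℝ}

theorem norm_le_of_mem_gelfandIntegral (hne : ∀ ω, (Γ ω).Nonempty) (hψ : Integrable ψ μ)
    (hb : ∀ ω, ∀ φ ∈ Γ ω, ‖φ‖ ≤ ψ ω) {g : X →L[ℝ] ℝ} (hg : g ∈ gelfandIntegral μ Γ) :
    ‖g‖ ≤ ∫ ω, ψ ω ∂μ := by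
  obtain ⟨f, ⟨-, hfΓ⟩, hg⟩ := hg
  have hψ0 : ∀ ω, 0 ≤ ψ ω := fun ω => (hne ω).elim fun φ h => (norm_nonneg φ).trans (hb ω φ h)
  refine g.opNorm_le_bound (integral_nonneg hψ0) fun x => ?_
  rw [hg x, ← integral_mul_const]
  refine norm_integral_le_of_norm_le (hψ.mul_const ‖x‖) ?_
  filter_upwards [hfΓ] with ω hω using (f ω).le_of_opNorm_le (hb ω _ hω) x

theorem piecewise_mem_selectors (hψ : Integrable ψ μ) (hb : ∀ ω, ∀ φ ∈ Γ ω, ‖φ‖ ≤ ψ ω)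
    {f₁ f₂ : Ω → X →L[ℝ] ℝ} (h₁ : f₁ ∈ selectors μ Γ) (h₂ : f₂ ∈ selectors μ Γ) {A : Set Ω}
    [DecidablePred (· ∈ A)] (hA : MeasurableSet A) :
    A.piecewise f₁ f₂ ∈ selectors μ Γ ∧ ∀ x, ∫ ω, A.piecewise f₁ f₂ ω x ∂μ =
      ∫ ω, f₂ ω x ∂μ + ∫ ω in A, (f₁ ω x - f₂ ω x) ∂μ := by
  obtain ⟨⟨hi₁, -⟩, hs₁⟩ := h₁
  obtain ⟨⟨hi₂, -⟩, hs₂⟩ := h₂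
  have heq : ∀ x, (fun ω => A.piecewise f₁ f₂ ω x) =
      A.piecewise (fun ω => f₁ ω x) fun ω => f₂ ω x := fun x => by
    ext ω
    by_cases h : ω ∈ A <;> simp [h]
  have hs : ∀ᵐ ω ∂μ, A.piecewise f₁ f₂ ω ∈ Γ ω := by
    filter_upwards [hs₁, hs₂] with ω h1 h2
    by_cases h : ω ∈ A <;> simpa [h]
  refine ⟨⟨gelfandIntegrable_of_norm_le hψ (fun x => ?_) (hs.mono fun ω => hb ω _), hs⟩,
    fun x => ?_⟩
  · rw [heq]
    exact (Integrable.piecewise hA (hi₁ x).integrableOn (hi₂ x).integrableOn).aestronglyMeasurable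
  · rw [heq, integral_piecewise hA (hi₁ x).integrableOn (hi₂ x).integrableOn,
      integral_sub (hi₁ x).integrableOn (hi₂ x).integrableOn, ← integral_add_compl hA (hi₂ x)]
    ring

theorem convex_closure_gelfandIntegral [IsFiniteMeasure μ] (hna : Nonatomic μ)
    (hψ : Integrable ψ μ) (hb : ∀ ω, ∀ φ ∈ Γ ω, ‖φ‖ ≤ ψ ω) :
    Convex ℝ (closure (wstar '' gelfandIntegral μ Γ)) := by
  classical
  intro g₁ hg₁ g₂ hg₂ a b ha _ hab
  rw [← closure_closure]
  refine map_mem_closure₂ (f := fun g g' : WeakDual ℝ X => a • g + b • g')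
    ((continuous_fst.const_smul a).add (continuous_snd.const_smul b)) hg₁ hg₂ ?_
  rintro _ ⟨g₁, ⟨f₁, hf₁, hg₁⟩, rfl⟩ _ ⟨g₂, ⟨f₂, hf₂, hg₂⟩, rfl⟩
  refine mem_closure_of_forall_finset fun F ε hε => ?_
  have hi : ∀ x : F, Integrable (fun ω => f₁ ω x - f₂ ω x) μ := fun x =>
    (hf₁.1.1 x).sub (hf₂.1.1 x)
  obtain ⟨A, hA, hAε⟩ := hna.exists_setIntegral_sub_smul_norm_lt
    (h := fun ω (x : F) => f₁ ω x - f₂ ω x) (Integrable.of_eval hi) ha (by linarith) hε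
  obtain ⟨hmem, hint⟩ := piecewise_mem_selectors hψ hb hf₁ hf₂ hA
  obtain ⟨g, hg⟩ := hmem.1.2
  refine ⟨wstar g, ⟨g, ⟨_, hmem, hg⟩, rfl⟩, fun x hx => ?_⟩
  refine lt_of_eq_of_lt ?_ ((norm_le_pi_norm _ (⟨x, hx⟩ : F)).trans_lt hAε)
  rw [Real.norm_eq_abs, Pi.sub_apply, Pi.smul_apply, eval_integral fun i => (hi i).integrableOn,
    eval_integral hi, integral_sub (hf₁.1.1 x) (hf₂.1.1 x), smul_eq_mul, ← hg₁, ← hg₂]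
  have h1 : (wstar g) x = g₂ x + ∫ ω in A, (f₁ ω x - f₂ ω x) ∂μ := by
    rw [hg₂]; exact (hg x).trans (hint x)
  have h2 : (a • wstar g₁ + b • wstar g₂) x = a * g₁ x + b * g₂ x := rfl
  rw [h1, h2]
  congr 1
  rw [← eq_sub_iff_add_eq'] at hab
  rw [hab]
  ring

end GelfandIntegral

section SupportIntegral

variable {X : Type u} [NormedAddCommGroup X] [NormedSpace ℝ X]
variable {Ω : Type v} [MeasurableSpace Ω] {μ : Measure Ω}
variable {Γ : Ω → Set (X →L[ℝ] ℝ)} {ψ : Ω → ℝ}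

theorem integrable_supp (hne : ∀ ω, (Γ ω).Nonempty) (hψ : Integrable ψ μ)
    (hb : ∀ ω, ∀ φ ∈ Γ ω, ‖φ‖ ≤ ψ ω) (hm : WScalarlyMeasurable Γ) (x : X) :
    Integrable (fun ω => supp x (Γ ω)) μ :=
  (hψ.mul_const ‖x‖).mono' (hm x).aestronglyMeasurable
    (Eventually.of_forall fun ω => abs_supp_le_s3 (hne ω) (hb ω) x)

theorem continuous_integral_supp (hne : ∀ ω, (Γ ω).Nonempty) (hψ : Integrable ψ μ)
    (hb : ∀ ω, ∀ φ ∈ Γ ω, ‖φ‖ ≤ ψ ω) (hm : WScalarlyMeasurable Γ) :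
    Continuous fun x : X => ∫ ω, supp x (Γ ω) ∂μ := by
  have hi := integrable_supp hne hψ hb hm
  refine (LipschitzWith.of_le_add_mul (∫ ω, ψ ω ∂μ).toNNReal fun x y => ?_).continuous
  have h1 : ∫ ω, supp x (Γ ω) ∂μ ≤ ∫ ω, (supp y (Γ ω) + ψ ω * ‖x - y‖) ∂μ :=
    integral_mono (hi x) ((hi y).add (hψ.mul_const _)) fun ω => supp_le_add (hne ω) (hb ω) x y
  rw [integral_add (hi y) (hψ.mul_const _), integral_mul_const] at h1
  refine h1.trans ?_
  rw [dist_eq_norm]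
  gcongr
  exact Real.le_coe_toNNReal _

theorem convexOn_integral_supp (hne : ∀ ω, (Γ ω).Nonempty) (hψ : Integrable ψ μ)
    (hb : ∀ ω, ∀ φ ∈ Γ ω, ‖φ‖ ≤ ψ ω) (hm : WScalarlyMeasurable Γ) :
    ConvexOn ℝ univ fun x : X => ∫ ω, supp x (Γ ω) ∂μ := by
  have hi := integrable_supp hne hψ hb hm
  refine ⟨convex_univ, fun x _ y _ a b ha hb' _ => ?_⟩
  have h1 : ∫ ω, supp (a • x + b • y) (Γ ω) ∂μ ≤
      ∫ ω, (a * supp x (Γ ω) + b * supp y (Γ ω)) ∂μ :=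
    integral_mono (hi _) (((hi x).const_mul a).add ((hi y).const_mul b))
      fun ω => supp_combo_le (hne ω) (hb ω) x y ha hb'
  rwa [integral_add ((hi x).const_mul a) ((hi y).const_mul b), integral_const_mul,
    integral_const_mul] at h1

/-- At a point of differentiability of the integral of the support functions, every pointwise
maximizer is a selector. -/
theorem mem_selectors_of_forall_eq_supp (hne : ∀ ω, (Γ ω).Nonempty) (hψ : Integrable ψ μ)
    (hb : ∀ ω, ∀ φ ∈ Γ ω, ‖φ‖ ≤ ψ ω) (hm : WScalarlyMeasurable Γ) {x : X}
    (hx : DifferentiableAt ℝ (fun y : X => ∫ ω, supp y (Γ ω) ∂μ) x) {f : Ω → X →L[ℝ] ℝ}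
    (hf : ∀ ω, f ω ∈ Γ ω) (hfx : ∀ ω, f ω x = supp x (Γ ω)) : f ∈ selectors μ Γ := by
  have hi := integrable_supp hne hψ hb hm
  refine ⟨gelfandIntegrable_of_norm_le hψ (fun v => ?_)
    (Eventually.of_forall fun ω => hb ω _ (hf ω)), Eventually.of_forall hf⟩
  have hpos : ∀ n : ℕ, 0 < (n : ℝ) + 1 := fun n => by positivity
  let q : X → ℕ → Ω → ℝ := fun w n ω =>
    ((n : ℝ) + 1) * (supp (x + ((n : ℝ) + 1)⁻¹ • w) (Γ ω) - supp x (Γ ω))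
  have hqm : ∀ w n, Measurable (q w n) := fun w n => ((hm _).sub (hm _)).const_mul _
  have hqi : ∀ w n, Integrable (q w n) μ := fun w n => ((hi _).sub (hi _)).const_mul _
  have hle : ∀ w n ω, f ω w ≤ q w n ω := fun w n ω => by
    have h1 := le_supp (hb ω) (hf ω) (x + ((n : ℝ) + 1)⁻¹ • w)
    rw [map_add, hfx, map_smul, smul_eq_mul] at h1
    have h2 : ((n : ℝ) + 1) * (((n : ℝ) + 1)⁻¹ * f ω w) = f ω w :=
      mul_inv_cancel_left₀ (hpos n).ne' _
    rw [← h2]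
    exact mul_le_mul_of_nonneg_left (by linarith) (hpos n).le
  have hqlim : ∀ w, Tendsto (fun n => ∫ ω, q w n ω ∂μ) atTop
      (𝓝 (fderiv ℝ (fun y : X => ∫ ω, supp y (Γ ω) ∂μ) x w)) := fun w => by
    have hc : Tendsto (fun n : ℕ => ‖(n : ℝ) + 1‖) atTop atTop :=
      tendsto_norm_atTop_atTop.comp
        (tendsto_atTop_add_const_right _ _ tendsto_natCast_atTop_atTop)
    refine (hx.hasFDerivAt.lim w hc).congr fun n => ?_
    rw [integral_const_mul, integral_sub (hi _) (hi _), smul_eq_mul]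
  refine aestronglyMeasurable_of_squeeze (l := fun n ω => -q (-v) n ω) (r := q v)
    (fun n => (hqm _ n).neg) (hqm v) (fun n => (hqi v n).sub (hqi _ n).neg)
    (fun n ω => ?_) (hle v) ?_
  · have h1 := hle (-v) n ω
    rw [map_neg] at h1
    linarith
  · have h1 := (hqlim v).add (hqlim (-v))
    rw [map_neg, add_neg_cancel] at h1
    refine h1.congr fun n => ?_
    rw [← integral_add (hqi v n) (hqi (-v) n)]
    simp only [sub_neg_eq_add]

theorem mem_closure_gelfandIntegral_of_le [IsFiniteMeasure μ] (hX : Asplund X)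
    (hna : Nonatomic μ) (hne : ∀ ω, (Γ ω).Nonempty) (hcl : ∀ ω, WStarClosed (Γ ω))
    (hψ : Integrable ψ μ) (hb : ∀ ω, ∀ φ ∈ Γ ω, ‖φ‖ ≤ ψ ω) (hm : WScalarlyMeasurable Γ)
    {g : X →L[ℝ] ℝ} (hg : ∀ x, g x ≤ ∫ ω, supp x (Γ ω) ∂μ) :
    wstar g ∈ closure (wstar '' gelfandIntegral μ Γ) := by
  by_contra hgn
  obtain ⟨x, c, hc, hcg⟩ := exists_lt_eval_of_notMem (convex_closure_gelfandIntegral hna hψ hb)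
    isClosed_closure hgn
  have hopen : IsOpen {y : X | c < g y - (∫ ω, ψ ω ∂μ) * ‖x - y‖} :=
    isOpen_lt continuous_const (by fun_prop)
  obtain ⟨y, hy, hyd⟩ := (hX.dense_differentiableAt (continuous_integral_supp hne hψ hb hm)
    (convexOn_integral_supp hne hψ hb hm)).inter_open_nonempty _ hopen
    ⟨x, show c < g x - (∫ ω, ψ ω ∂μ) * ‖x - x‖ by
      rw [sub_self, norm_zero, mul_zero, sub_zero]; exact hcg⟩
  choose f hf hfy using fun ω => exists_eq_supp (hne ω) (hcl ω) (hb ω) y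
  have hsel := mem_selectors_of_forall_eq_supp hne hψ hb hm hyd hf hfy
  obtain ⟨φ, hφ⟩ := hsel.1.2
  have hφI : φ ∈ gelfandIntegral μ Γ := ⟨f, hsel, hφ⟩
  have h1 : φ x < c := hc _ (subset_closure ⟨φ, hφI, rfl⟩)
  have h2 : φ y = ∫ ω, supp y (Γ ω) ∂μ := by rw [hφ]; simp_rw [hfy]
  have h3 := neg_le_of_abs_le
    (φ.le_of_opNorm_le (norm_le_of_mem_gelfandIntegral hne hψ hb hφI) (x - y))
  rw [map_sub] at h3
  have h4 := hg y
  have h5 : c < g y - (∫ ω, ψ ω ∂μ) * ‖x - y‖ := hy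
  linarith

end SupportIntegral

theorem exists_tendsto_inner_of_norm_le {H : Type*} [NormedAddCommGroup H] [InnerProductSpace ℝ H]
    [CompleteSpace H] {α : Type*} (U : Ultrafilter α) {T : α → H} {C : ℝ} (hT : ∀ a, ‖T a‖ ≤ C) :
    ∃ h : H, ∀ k, Tendsto (fun a => inner ℝ (T a) k) U (𝓝 (inner ℝ h k)) := by
  let Φ : α → WeakDual ℝ H := fun a =>
    StrongDual.toWeakDual (InnerProductSpace.toDual ℝ H (T a))
  obtain ⟨φ, -, hφ⟩ := (WeakDual.isCompact_closedBall (𝕜 := ℝ)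
    (0 : StrongDual ℝ H) C).ultrafilter_le_nhds' (U.map Φ) (Ultrafilter.mem_map.2 (Eventually.of_forall fun a => by
      have : ‖InnerProductSpace.toDual ℝ H (T a)‖ ≤ C := by
        rw [LinearIsometryEquiv.norm_map]; exact hT a
      exact mem_closedBall_zero_iff.2 this))
  refine ⟨(InnerProductSpace.toDual ℝ H).symm (WeakDual.toStrongDual φ), fun k => ?_⟩
  rw [InnerProductSpace.toDual_symm_apply]
  have h1 : Tendsto Φ U (𝓝 φ) := hφ
  exact ((WeakDual.eval_continuous k).tendsto φ).comp h1

/-- Dominated families of integrable functions are weakly relatively compact: every ultrafilter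
has a limit in the sense of integrals over measurable sets. -/
theorem exists_integrable_tendsto_setIntegral {Ω : Type v} [MeasurableSpace Ω] {μ : Measure Ω}
    {α : Type*} (U : Ultrafilter α) {v : α → Ω → ℝ} {w : Ω → ℝ} {C : ℝ} (hw : Integrable w μ)
    (hw0 : ∀ ω, 0 < w ω) (hv : ∀ a, AEStronglyMeasurable (v a) μ)
    (hvw : ∀ a, ∀ᵐ ω ∂μ, |v a ω| ≤ C * w ω) :
    ∃ f : Ω → ℝ, Integrable f μ ∧ ∀ A, MeasurableSet A →
      Tendsto (fun a => ∫ ω in A, v a ω ∂μ) U (𝓝 (∫ ω in A, f ω ∂μ)) := by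
  set s : Ω → ℝ := fun ω => √(w ω) with hs
  have hs0 : ∀ ω, 0 < s ω := fun ω => Real.sqrt_pos.2 (hw0 ω)
  have hss : ∀ ω, s ω * s ω = w ω := fun ω => Real.mul_self_sqrt (hw0 ω).le
  have hsm : AEStronglyMeasurable s μ := Real.continuous_sqrt.comp_aestronglyMeasurable hw.1
  have hs2 : MemLp s 2 μ := (memLp_two_iff_integrable_sq hsm).2 (by simpa only [sq, hss] using hw)
  have hle : ∀ a, ∀ᵐ ω ∂μ, ‖v a ω / s ω‖ ≤ ‖C * s ω‖ := fun a => by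
    filter_upwards [hvw a] with ω hω
    rw [Real.norm_eq_abs, abs_div, abs_of_pos (hs0 ω), div_le_iff₀ (hs0 ω), Real.norm_eq_abs]
    calc |v a ω| ≤ C * s ω * s ω := by rwa [mul_assoc, hss]
      _ ≤ |C * s ω| * s ω := by exact mul_le_mul_of_nonneg_right (le_abs_self _) (hs0 ω).le
  have hq : ∀ a, MemLp (fun ω => v a ω / s ω) 2 μ := fun a =>
    (hs2.const_mul C).mono ((hv a).aemeasurable.div hsm.aemeasurable).aestronglyMeasurable (hle a)
  obtain ⟨h, hh⟩ := exists_tendsto_inner_of_norm_le U (T := fun a => (hq a).toLp)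
    (C := ‖(hs2.const_mul C).toLp‖) fun a => Lp.norm_le_norm_of_ae_le (by
      filter_upwards [(hq a).coeFn_toLp, (hs2.const_mul C).coeFn_toLp, hle a] with ω h1 h2 h3
      rwa [h1, h2])
  refine ⟨fun ω => h ω * s ω, (Lp.memLp h).integrable_mul hs2, fun A hA => ?_⟩
  have hsA := hs2.indicator hA
  have key : ∀ (p : Lp ℝ 2 μ) (q : Ω → ℝ), (∀ᵐ ω ∂μ, p ω * s ω = q ω) →
      inner ℝ p hsA.toLp = ∫ ω in A, q ω ∂μ := fun p q hpq => by
    rw [L2.inner_def, ← integral_indicator hA]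
    refine integral_congr_ae ?_
    filter_upwards [hsA.coeFn_toLp, hpq] with ω h1 h2
    rw [h1, RCLike.inner_apply, conj_trivial, mul_comm]
    by_cases hω : ω ∈ A
    · rw [indicator_of_mem hω, indicator_of_mem hω, h2]
    · rw [indicator_of_notMem hω, indicator_of_notMem hω, mul_zero]
  have h1 := hh hsA.toLp
  rw [key h _ (Eventually.of_forall fun ω => rfl)] at h1
  refine h1.congr fun a => key _ _ ?_
  filter_upwards [(hq a).coeFn_toLp] with ω h2
  rw [h2, div_mul_cancel₀ _ (hs0 ω).ne']

section WeakLimit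

variable {X : Type u} [NormedAddCommGroup X] [NormedSpace ℝ X]
variable {Ω : Type v} [MeasurableSpace Ω] {μ : Measure Ω}
variable {Γ : Ω → Set (X →L[ℝ] ℝ)} {ψ : Ω → ℝ}

theorem exists_density_of_mem_closure [IsFiniteMeasure μ] (hne : ∀ ω, (Γ ω).Nonempty)
    (hψ : Integrable ψ μ) (hb : ∀ ω, ∀ φ ∈ Γ ω, ‖φ‖ ≤ ψ ω) (hm : WScalarlyMeasurable Γ)
    {g : X →L[ℝ] ℝ} (hg : wstar g ∈ closure (wstar '' gelfandIntegral μ Γ)) :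
    ∃ q : X → Ω → ℝ, (∀ x, Integrable (q x) μ) ∧ (∀ x, g x = ∫ ω, q x ω ∂μ) ∧
      ∀ (F : Finset X) (c : F → ℝ), ∀ᵐ ω ∂μ,
        ∑ x, c x * q x ω ≤ supp (∑ x, c x • (x : X)) (Γ ω) := by
  have hψ0 : ∀ ω, 0 ≤ ψ ω := fun ω => (hne ω).elim fun φ h => (norm_nonneg φ).trans (hb ω φ h)
  obtain ⟨U, hUS, hUg⟩ := mem_closure_iff_ultrafilter.1 hg
  obtain ⟨_, φ₀, ⟨f₀, hf₀, -⟩, -⟩ := closure_nonempty_iff.1 ⟨_, hg⟩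
  have hf : ∀ φ : WeakDual ℝ X, ∃ f ∈ selectors μ Γ,
      φ ∈ wstar '' gelfandIntegral μ Γ → ∀ x, φ x = ∫ ω, f ω x ∂μ := fun φ => by
    by_cases h : φ ∈ wstar '' gelfandIntegral μ Γ
    · obtain ⟨φ, ⟨f, hf, hφ⟩, rfl⟩ := h
      exact ⟨f, hf, fun _ => hφ⟩
    · exact ⟨f₀, hf₀, fun h' => absurd h' h⟩
  choose f hfs hf using hf
  have hq := fun x => exists_integrable_tendsto_setIntegral U (v := fun φ ω => f φ ω x)
    (w := fun ω => 1 + ψ ω) (C := ‖x‖) ((integrable_const 1).add hψ)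
    (fun ω => by linarith [hψ0 ω]) (fun φ => ((hfs φ).1.1 x).1) (fun φ => by
      filter_upwards [(hfs φ).2] with ω hω
      have h1 := (f φ ω).le_of_opNorm_le (hb ω _ hω) x
      rw [Real.norm_eq_abs] at h1
      nlinarith [norm_nonneg x])
  choose q hqi hq using hq
  refine ⟨q, hqi, fun x => ?_, fun F c => ?_⟩
  · have h1 : Tendsto (fun φ : WeakDual ℝ X => φ x) U (𝓝 (g x)) :=
      ((WeakDual.eval_continuous x).tendsto (wstar g)).mono_left hUg
    have h2 := hq x univ MeasurableSet.univ
    simp only [setIntegral_univ] at h2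
    refine tendsto_nhds_unique h1 (h2.congr' ?_)
    filter_upwards [hUS] with φ hφ using (hf φ hφ x).symm
  · refine ae_le_of_forall_setIntegral_le (integrable_finsetSum _ fun x _ => (hqi x).const_mul _)
      (integrable_supp hne hψ hb hm _) fun A hA _ => ?_
    rw [integral_finsetSum Finset.univ fun (x : F) _ => ((hqi x).const_mul (c x)).integrableOn]
    simp_rw [integral_const_mul]
    refine le_of_tendsto' (tendsto_finsetSum _ fun x _ => (hq x A hA).const_mul (c x)) fun φ => ?_
    simp_rw [← integral_const_mul]
    rw [← integral_finsetSum Finset.univ fun (x : F) _ =>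
      (((hfs φ).1.1 x).const_mul (c x)).integrableOn]
    refine integral_mono_ae (integrable_finsetSum _ fun x _ =>
      (((hfs φ).1.1 x).const_mul _).integrableOn)
      (integrable_supp hne hψ hb hm _).integrableOn (ae_restrict_of_ae ?_)
    filter_upwards [(hfs φ).2] with ω hω
    refine le_trans (le_of_eq ?_) (le_supp (hb ω) hω _)
    simp only [map_sum, map_smul, smul_eq_mul]

end WeakLimit

section Interpolation

variable {X : Type u} [NormedAddCommGroup X] [NormedSpace ℝ X]

theorem isCompact_wstar_le_supp {Q : Set (X →L[ℝ] ℝ)} (hQ : Q.Nonempty) {R : ℝ}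
    (hR : ∀ φ ∈ Q, ‖φ‖ ≤ R) :
    IsCompact (wstar '' {φ : X →L[ℝ] ℝ | ∀ x, φ x ≤ supp x Q}) :=
  isCompact_wstar_image (isClosed_wstar_le _) fun _ hφ => norm_le_of_le_supp hQ hR hφ

/-- Finite interpolation by functionals dominated by a support function. -/
theorem exists_le_supp_forall_eq {Q : Set (X →L[ℝ] ℝ)} (hQ : Q.Nonempty) (hcl : WStarClosed Q)
    {R : ℝ} (hR : ∀ φ ∈ Q, ‖φ‖ ≤ R) {F : Finset X} {a : X → ℝ}
    (h : ∀ c : F → ℚ, ∑ x, (c x : ℝ) * a x ≤ supp (∑ x, (c x : ℝ) • (x : X)) Q) :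
    ∃ φ ∈ wstar '' {φ : X →L[ℝ] ℝ | ∀ x, φ x ≤ supp x Q}, ∀ x ∈ F, φ x = a x := by
  classical
  have hreal : ∀ c : F → ℝ, ∑ x, c x * a x ≤ supp (∑ x, c x • (x : X)) Q := fun c => by
    have hd : DenseRange (Pi.map fun (_ : F) (r : ℚ) => (r : ℝ)) :=
      DenseRange.piMap fun _ => Rat.denseRange_cast
    refine hd.induction_on (p := fun c : F → ℝ => ∑ x, c x * a x ≤ supp (∑ x, c x • (x : X)) Q) c
      (isClosed_le (by fun_prop) ((continuous_supp hQ hR).comp (by fun_prop))) h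
  let ev : WeakDual ℝ X →ₗ[ℝ] F → ℝ :=
    { toFun := fun φ x => φ x
      map_add' := fun _ _ => rfl
      map_smul' := fun _ _ => rfl }
  have hev : Continuous ev := continuous_pi fun x => WeakDual.eval_continuous (x : X)
  by_contra hno
  have ha : (fun x : F => a x) ∉
      ev '' (wstar '' {φ : X →L[ℝ] ℝ | ∀ x, φ x ≤ supp x Q}) := by
    rintro ⟨φ, hφ, hφa⟩
    exact hno ⟨φ, hφ, fun x hx => congrFun hφa ⟨x, hx⟩⟩
  obtain ⟨f, c, h1, h2⟩ := geometric_hahn_banach_closed_point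
    ((convex_wstar_le fun x => supp x Q).linear_image ev)
    ((isCompact_wstar_le_supp hQ hR).image hev).isClosed ha
  have hsum : ∀ b : F → ℝ, f b = ∑ x, f (Pi.single x 1) * b x := fun b => by
    rw [← ContinuousLinearMap.coe_coe, LinearMap.pi_apply_eq_sum_univ]
    refine Finset.sum_congr rfl fun x _ => ?_
    rw [smul_eq_mul, mul_comm]
    congr 2
    ext y
    simp [Pi.single_apply, eq_comm]
  obtain ⟨φ, hφ, hφs⟩ := exists_eq_supp hQ hcl hR (∑ x : F, f (Pi.single x 1) • (x : X))
  have h3 := h1 _ ⟨_, ⟨φ, fun x => le_supp hR hφ x, rfl⟩, rfl⟩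
  have h4 := hreal fun x => f (Pi.single x 1)
  rw [hsum] at h2 h3
  rw [← hφs, map_sum] at h4
  simp_rw [map_smul, smul_eq_mul] at h4
  exact absurd (h2.trans_le h4) (not_lt.2 h3.le)

end Interpolation

/-- over a complete nonatomic finite measure space, for `X` Asplund with
`dens(X) < κ(μ)`, the weak*-closure of the Gelfand integral of an integrably bounded,
w*-scalarly measurable multifunction with nonempty w*-closed values is weak*-compact
and convex, and equals the Gelfand integral of the weak*-closed convex hull mapping. -/
theorem closure_gelfand_integral_convex
    {X : Type u} [NormedAddCommGroup X] [NormedSpace ℝ X] [CompleteSpace X]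
    (hX : Asplund X)
    {Ω : Type v} [MeasurableSpace Ω] (μ : Measure Ω)
    (hcomp : μ.IsComplete) [IsFiniteMeasure μ]
    (hna : Nonatomic μ)
    (hdens : DensLtAdditivity X μ)
    (Γ : Ω → Set (X →L[ℝ] ℝ))
    (hne : ∀ ω, (Γ ω).Nonempty)
    (hcl : ∀ ω, WStarClosed (Γ ω))
    (hb : IntegrablyBounded μ Γ)
    (hm : WScalarlyMeasurable Γ)
    (hsel : (selectors μ Γ).Nonempty) :
    IsCompact (closure (wstar '' gelfandIntegral μ Γ)) ∧
    Convex ℝ (closure (wstar '' gelfandIntegral μ Γ)) ∧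
    wstarClosure (gelfandIntegral μ Γ) =
      gelfandIntegral μ (fun ω => wstarClosedConvexHull (Γ ω)) := by
  obtain ⟨ψ, hψ, hb⟩ := hb
  have hhull : ∀ ω φ, φ ∈ wstarClosedConvexHull (Γ ω) ↔ ∀ x, φ x ≤ supp x (Γ ω) :=
    fun ω φ => mem_wstarClosedConvexHull_iff (hne ω) (hb ω)
  refine ⟨?_, convex_closure_gelfandIntegral hna hψ hb, Subset.antisymm (fun g hg => ?_) ?_⟩
  · refine (WeakDual.isCompact_closedBall (𝕜 := ℝ) (0 : X →L[ℝ] ℝ)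
      (∫ ω, ψ ω ∂μ)).of_isClosed_subset isClosed_closure
      (closure_minimal ?_ (WeakDual.isClosed_closedBall _ _))
    rintro _ ⟨φ, hφ, rfl⟩
    exact mem_closedBall_zero_iff.2 (norm_le_of_mem_gelfandIntegral hne hψ hb hφ)
  · obtain ⟨q, hqi, hgq, hq⟩ := exists_density_of_mem_closure hne hψ hb hm hg
    let K : Ω → Set (WeakDual ℝ X) := fun ω => wstar '' {φ | ∀ x, φ x ≤ supp x (Γ ω)}
    have hK : ∀ ω, IsCompact (K ω) := fun ω => isCompact_wstar_le_supp (hne ω) (hb ω)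
    have hKb : ∀ ω, ∀ φ ∈ K ω, ‖WeakDual.toStrongDual φ‖ ≤ ψ ω := by
      rintro ω _ ⟨φ, hφ, rfl⟩
      exact norm_le_of_le_supp (hne ω) (hb ω) hφ
    have hqK : CountablyInterpolable μ q K := CountablyInterpolable.of_finset hK fun F => by
      have h1 : ∀ᵐ ω ∂μ, ∀ c : F → ℚ, ∑ x, (c x : ℝ) * q x ω ≤
          supp (∑ x, (c x : ℝ) • (x : X)) (Γ ω) := ae_all_iff.2 fun c => hq F _
      filter_upwards [h1] with ω hω
      exact exists_le_supp_forall_eq (a := fun x => q x ω) (hne ω) (hcl ω) (hb ω) hω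
    obtain ⟨f, hfK, hfq⟩ := hqK.exists_selector hcomp hX hdens hK fun ω => ⟨ψ ω, hKb ω⟩
    have hgf : ∀ x, g x = ∫ ω, f ω x ∂μ := fun x => by
      rw [hgq x]
      exact integral_congr_ae ((hfq x).mono fun ω h => h.symm)
    refine ⟨f, ⟨⟨fun x => (hqi x).congr ((hfq x).mono fun ω h => h.symm), g, hgf⟩, ?_⟩, hgf⟩
    filter_upwards [hfK] with ω hω
    obtain ⟨φ, hφ, hφf⟩ := hω
    rw [← hφf]
    exact (hhull ω φ).2 hφ
  · rintro g ⟨f, ⟨⟨hfi, -⟩, hfΓ⟩, hgf⟩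
    refine mem_closure_gelfandIntegral_of_le hX hna hne hcl hψ hb hm fun x => ?_
    rw [hgf x]
    refine integral_mono_ae (hfi x) (integrable_supp hne hψ hb hm x) ?_
    filter_upwards [hfΓ] with ω hω using (hhull ω _).1 hω x

end Paper
end
end
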